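/- Let G be a unicyclic graph. Then dim(G) − edim(G) = 1 if G is ABC-positive and ADE-negative; dim(G) − edim(G) = −1 if G is ABC-negative and ADE-positive; and dim(G) − edim(G) = 0 otherwise. -/

import Mathlib

open SimpleGraph

section Defs

variable {V : Type*}

/-- Distance from a vertex `s` to an edge `e`: the minimum of the distances to its endpoints. -/
noncomputable def edgeDist (G : SimpleGraph V) (s : V) (e : Sym2 V) : ℕ :=
  Sym2.lift ⟨fun u w => min (G.dist s u) (G.dist s w), fun u w => min_comm _ _⟩ e

/-- `S` is a vertex metric generator of `G`. -/
def IsVertexMG (G : SimpleGraph V) (S : Set V) : Prop :=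
  ∀ u v : V, u ≠ v → ∃ s ∈ S, G.dist s u ≠ G.dist s v

/-- `S` is an edge metric generator of `G`. -/
def IsEdgeMG (G : SimpleGraph V) (S : Set V) : Prop :=
  ∀ e ∈ G.edgeSet, ∀ f ∈ G.edgeSet, e ≠ f → ∃ s ∈ S, edgeDist G s e ≠ edgeDist G s f

/-- The vertex metric dimension of `G`. -/
noncomputable def metricDim (G : SimpleGraph V) : ℕ :=
  sInf {n | ∃ S : Finset V, S.card = n ∧ IsVertexMG G ↑S}

/-- The edge metric dimension of `G`. -/
noncomputable def edgeMetricDim (G : SimpleGraph V) : ℕ :=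
  sInf {n | ∃ S : Finset V, S.card = n ∧ IsEdgeMG G ↑S}

/-- `G` is unicyclic: connected, contains a cycle, and any two cycles have the same edges. -/
def IsUnicyclic (G : SimpleGraph V) : Prop :=
  G.Connected ∧ (∃ (u : V) (w : G.Walk u u), w.IsCycle) ∧
    ∀ (u u' : V) (w : G.Walk u u) (w' : G.Walk u' u'), w.IsCycle → w'.IsCycle →
      ∀ e, e ∈ w.edges ↔ e ∈ w'.edges

/-- `vc : ZMod g → V` is a labelling `v_0 v_1 ⋯ v_{g-1}` of a cycle of length `g` in `G`. -/
def IsCycleLabelling (G : SimpleGraph V) (g : ℕ) (vc : ZMod g → V) : Prop :=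
  Function.Injective vc ∧ ∀ i : ZMod g, G.Adj (vc i) (vc (i + 1))

/-- The set of edges of the cycle `C`. -/
def cycleEdges (g : ℕ) (vc : ZMod g → V) : Set (Sym2 V) :=
  {e | ∃ i : ZMod g, e = s(vc i, vc (i + 1))}

/-- The graph `G - E(C)`. -/
def offCycle (G : SimpleGraph V) (g : ℕ) (vc : ZMod g → V) : SimpleGraph V :=
  G.deleteEdges (cycleEdges g vc)

/-- `x` belongs to `T_{v_i}`, the connected component of `G - E(C)` containing `v_i`. -/
def inTree (G : SimpleGraph V) (g : ℕ) (vc : ZMod g → V) (i : ZMod g) (x : V) : Prop :=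
  (offCycle G g vc).Reachable (vc i) x

/-- The vertex `v_i` of the cycle is `S`-active: `T_{v_i}` contains a vertex of `S`. -/
def SActive (G : SimpleGraph V) (g : ℕ) (vc : ZMod g → V) (S : Set V) (i : ZMod g) : Prop :=
  ∃ s ∈ S, inTree G g vc i s

/-- `a_S(C)`: the number of `S`-active vertices on the cycle. -/
noncomputable def aS (G : SimpleGraph V) (g : ℕ) (vc : ZMod g → V) (S : Set V) : ℕ :=
  {i : ZMod g | SActive G g vc S i}.ncard

/-- `S` is biactive: `a_S(C) ≥ 2`. -/
def Biactive (G : SimpleGraph V) (g : ℕ) (vc : ZMod g → V) (S : Set V) : Prop :=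
  2 ≤ aS G g vc S

variable [Fintype V] [DecidableEq V]

/-- `t = u_1 u_2 ⋯ u_k` is a thread hanging at the vertex `v`. -/
def IsThreadAt (G : SimpleGraph V) [DecidableRel G.Adj] (v : V) (t : List V) : Prop :=
  t ≠ [] ∧ t.Nodup ∧ v ∉ t ∧ 3 ≤ G.degree v ∧ List.Chain' G.Adj t ∧
    (∀ u ∈ t.head?, G.Adj v u) ∧ (∀ u ∈ t.getLast?, G.degree u = 1) ∧
    ∀ u ∈ t.dropLast, G.degree u = 2

/-- The thread `t` is `S`-free: it contains no vertex of `S`. -/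
def SFree (S : Set V) (t : List V) : Prop := ∀ u ∈ t, u ∉ S

/-- `S` is branch-resolving: for every vertex, all threads hanging at it except possibly
one contain a vertex of `S` (i.e. at most one thread at each vertex is `S`-free). -/
def BranchResolving (G : SimpleGraph V) [DecidableRel G.Adj] (S : Set V) : Prop :=
  ∀ v : V, ∀ t₁ t₂ : List V, IsThreadAt G v t₁ → IsThreadAt G v t₂ → t₁ ≠ t₂ →
    (∃ s ∈ S, s ∈ t₁) ∨ (∃ s ∈ S, s ∈ t₂)

/-- `ℓ(v)`: the number of threads hanging at `v`. -/
noncomputable def numThreads (G : SimpleGraph V) [DecidableRel G.Adj] (v : V) : ℕ :=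
  {t : List V | IsThreadAt G v t}.ncard

/-- `L(G) = Σ (ℓ(v) - 1)` (truncated subtraction makes the sum run exactly over the
vertices with `ℓ(v) > 1`). -/
noncomputable def LG (G : SimpleGraph V) [DecidableRel G.Adj] : ℕ :=
  ∑ v : V, (numThreads G v - 1)

/-- `x` is a branching vertex of the unicyclic graph with cycle `vc`. -/
def Branching (G : SimpleGraph V) [DecidableRel G.Adj] (g : ℕ) (vc : ZMod g → V) (x : V) :
    Prop :=
  (x ∉ Set.range vc ∧ 3 ≤ G.degree x) ∨ (x ∈ Set.range vc ∧ 4 ≤ G.degree x)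

/-- The cycle vertex `v_i` is branch-active: `T_{v_i}` contains a branching vertex. -/
def BranchActive (G : SimpleGraph V) [DecidableRel G.Adj] (g : ℕ) (vc : ZMod g → V)
    (i : ZMod g) : Prop :=
  ∃ x, inTree G g vc i x ∧ Branching G g vc x

/-- `b(G)`: the number of branch-active vertices on the cycle. -/
noncomputable def bG (G : SimpleGraph V) [DecidableRel G.Adj] (g : ℕ) (vc : ZMod g → V) : ℕ :=
  {i : ZMod g | BranchActive G g vc i}.ncard

/-- `k = max { i : v_i is S-active }` for the labelling `vc` (indices taken in `[0, g-1]`). -/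
noncomputable def kOf (G : SimpleGraph V) (g : ℕ) (vc : ZMod g → V) (S : Set V) : ℕ :=
  sSup {n : ℕ | n < g ∧ SActive G g vc S (n : ZMod g)}

/-- The labelling `vc` of the cycle is canonical with respect to `S`: `v_0` is `S`-active
and `k` is as small as possible among all labellings of the cycle with `v_0` `S`-active. -/
def Canonical (G : SimpleGraph V) (g : ℕ) (vc : ZMod g → V) (S : Set V) : Prop :=
  IsCycleLabelling G g vc ∧ SActive G g vc S 0 ∧
    ∀ vc' : ZMod g → V, IsCycleLabelling G g vc' → Set.range vc' = Set.range vc →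
      SActive G g vc' S 0 → kOf G g vc S ≤ kOf G g vc' S

/-- Configuration 𝒜 : `a_S(C) = 2`, `g` even and `k = g/2`. -/
def ConfigA (G : SimpleGraph V) (g : ℕ) (vc : ZMod g → V) (S : Set V) : Prop :=
  aS G g vc S = 2 ∧ Even g ∧ kOf G g vc S = g / 2

/-- Configuration ℬ : `k ≤ ⌊g/2⌋ - 1` and an `S`-free thread hangs at `v_i` for some
`i ∈ [k, ⌊g/2⌋-1] ∪ [⌈g/2⌉+k+1, g-1] ∪ {0}`. -/
def ConfigB (G : SimpleGraph V) [DecidableRel G.Adj] (g : ℕ) (vc : ZMod g → V) (S : Set V) :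
    Prop :=
  kOf G g vc S ≤ g / 2 - 1 ∧
    ∃ i : ℕ, ((kOf G g vc S ≤ i ∧ i ≤ g / 2 - 1) ∨
        ((g + 1) / 2 + kOf G g vc S + 1 ≤ i ∧ i ≤ g - 1) ∨ i = 0) ∧
      ∃ t : List V, IsThreadAt G (vc (i : ZMod g)) t ∧ SFree S t

/-- Configuration 𝒞 : `a_S(C) = 2`, `g` even, `k ≤ g/2` and an `S`-free thread of length
`≥ g/2 - k` hangs at `v_i` for some `i ∈ [0, k]`. -/
def ConfigC (G : SimpleGraph V) [DecidableRel G.Adj] (g : ℕ) (vc : ZMod g → V) (S : Set V) :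
    Prop :=
  aS G g vc S = 2 ∧ Even g ∧ kOf G g vc S ≤ g / 2 ∧
    ∃ i : ℕ, i ≤ kOf G g vc S ∧
      ∃ t : List V, IsThreadAt G (vc (i : ZMod g)) t ∧ SFree S t ∧
        g / 2 - kOf G g vc S ≤ t.length

/-- Configuration 𝒟 : `k ≤ ⌈g/2⌉ - 1` and an `S`-free thread hangs at `v_i` for some
`i ∈ [k, ⌈g/2⌉-1] ∪ [⌊g/2⌋+k+1, g-1] ∪ {0}`. -/
def ConfigD (G : SimpleGraph V) [DecidableRel G.Adj] (g : ℕ) (vc : ZMod g → V) (S : Set V) :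
    Prop :=
  kOf G g vc S ≤ (g + 1) / 2 - 1 ∧
    ∃ i : ℕ, ((kOf G g vc S ≤ i ∧ i ≤ (g + 1) / 2 - 1) ∨
        (g / 2 + kOf G g vc S + 1 ≤ i ∧ i ≤ g - 1) ∨ i = 0) ∧
      ∃ t : List V, IsThreadAt G (vc (i : ZMod g)) t ∧ SFree S t

/-- Configuration ℰ : `a_S(C) = 2` and an `S`-free thread of length `≥ ⌊g/2⌋ - k + 1`
hangs at `v_i` with `i ∈ [0, k]`; moreover if `g` is even an `S`-free thread hangs at
`v_j` with `j = g/2 + k - i`. -/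
def ConfigE (G : SimpleGraph V) [DecidableRel G.Adj] (g : ℕ) (vc : ZMod g → V) (S : Set V) :
    Prop :=
  aS G g vc S = 2 ∧
    ∃ i : ℕ, i ≤ kOf G g vc S ∧
      (∃ t : List V, IsThreadAt G (vc (i : ZMod g)) t ∧ SFree S t ∧
        g / 2 - kOf G g vc S + 1 ≤ t.length) ∧
      (Even g → ∃ t' : List V,
        IsThreadAt G (vc ((g / 2 + kOf G g vc S - i : ℕ) : ZMod g)) t' ∧ SFree S t')

/-- `G` contains configuration 𝒜 with respect to `S` (evaluated on a canonical labelling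
of the cycle given by `vc`). -/
def ContainsA (G : SimpleGraph V) (g : ℕ) (vc : ZMod g → V) (S : Set V) : Prop :=
  ∃ vc' : ZMod g → V, IsCycleLabelling G g vc' ∧ Set.range vc' = Set.range vc ∧
    Canonical G g vc' S ∧ ConfigA G g vc' S

/-- `G` contains configuration ℬ with respect to `S`. -/
def ContainsB (G : SimpleGraph V) [DecidableRel G.Adj] (g : ℕ) (vc : ZMod g → V)
    (S : Set V) : Prop :=
  ∃ vc' : ZMod g → V, IsCycleLabelling G g vc' ∧ Set.range vc' = Set.range vc ∧
    Canonical G g vc' S ∧ ConfigB G g vc' S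

/-- `G` contains configuration 𝒞 with respect to `S`. -/
def ContainsC (G : SimpleGraph V) [DecidableRel G.Adj] (g : ℕ) (vc : ZMod g → V)
    (S : Set V) : Prop :=
  ∃ vc' : ZMod g → V, IsCycleLabelling G g vc' ∧ Set.range vc' = Set.range vc ∧
    Canonical G g vc' S ∧ ConfigC G g vc' S

/-- `G` contains configuration 𝒟 with respect to `S`. -/
def ContainsD (G : SimpleGraph V) [DecidableRel G.Adj] (g : ℕ) (vc : ZMod g → V)
    (S : Set V) : Prop :=
  ∃ vc' : ZMod g → V, IsCycleLabelling G g vc' ∧ Set.range vc' = Set.range vc ∧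
    Canonical G g vc' S ∧ ConfigD G g vc' S

/-- `G` contains configuration ℰ with respect to `S`. -/
def ContainsE (G : SimpleGraph V) [DecidableRel G.Adj] (g : ℕ) (vc : ZMod g → V)
    (S : Set V) : Prop :=
  ∃ vc' : ZMod g → V, IsCycleLabelling G g vc' ∧ Set.range vc' = Set.range vc ∧
    Canonical G g vc' S ∧ ConfigE G g vc' S

/-- `G` contains one of the configurations 𝒜, ℬ, 𝒞 with respect to `S`. -/
def ContainsABC (G : SimpleGraph V) [DecidableRel G.Adj] (g : ℕ) (vc : ZMod g → V)
    (S : Set V) : Prop :=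
  ContainsA G g vc S ∨ ContainsB G g vc S ∨ ContainsC G g vc S

/-- `G` contains one of the configurations 𝒜, 𝒟, ℰ with respect to `S`. -/
def ContainsADE (G : SimpleGraph V) [DecidableRel G.Adj] (g : ℕ) (vc : ZMod g → V)
    (S : Set V) : Prop :=
  ContainsA G g vc S ∨ ContainsD G g vc S ∨ ContainsE G g vc S

/-- `S` is a smallest branch-resolving set of `G`. -/
def SmallestBR (G : SimpleGraph V) [DecidableRel G.Adj] (S : Finset V) : Prop :=
  BranchResolving G ↑S ∧ ∀ S' : Finset V, BranchResolving G ↑S' → S.card ≤ S'.card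

/-- `S` is a smallest biactive branch-resolving set of `G`. -/
def SmallestBBR (G : SimpleGraph V) [DecidableRel G.Adj] (g : ℕ) (vc : ZMod g → V)
    (S : Finset V) : Prop :=
  BranchResolving G ↑S ∧ Biactive G g vc ↑S ∧
    ∀ S' : Finset V, BranchResolving G ↑S' → Biactive G g vc ↑S' → S.card ≤ S'.card

/-- `G` is 𝒜ℬ𝒞-negative. -/
def ABCneg (G : SimpleGraph V) [DecidableRel G.Adj] (g : ℕ) (vc : ZMod g → V) : Prop :=
  ∃ S : Finset V, SmallestBBR G g vc S ∧ ¬ ContainsABC G g vc ↑S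

/-- `G` is 𝒜𝒟ℰ-negative. -/
def ADEneg (G : SimpleGraph V) [DecidableRel G.Adj] (g : ℕ) (vc : ZMod g → V) : Prop :=
  ∃ S : Finset V, SmallestBBR G g vc S ∧ ¬ ContainsADE G g vc ↑S

end Defs

/-- A unicyclic graph has as many edges as vertices. -/
theorem IsUnicyclic.card_edgeFinset {V : Type*} [Fintype V] [DecidableEq V] {G : SimpleGraph V}
    [DecidableRel G.Adj] (hG : IsUnicyclic G) : G.edgeFinset.card = Fintype.card V := by
  obtain ⟨hconn, ⟨u, w, hw⟩, huniq⟩ := hG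
  obtain ⟨e, he⟩ : ∃ e, e ∈ w.edges := List.exists_mem_of_ne_nil _ (by
    intro h0
    have h1 := hw.three_le_length
    rw [← Walk.length_edges, h0] at h1
    simp at h1)
  induction e using Sym2.ind with
  | _ a b =>
  have heG : s(a, b) ∈ G.edgeSet := w.edges_subset_edgeSet he
  have hnb : ¬ G.IsBridge s(a, b) := fun hb => hb.notMem_edges_of_isCycle hw he
  have hac : (G.deleteEdges {s(a, b)}).IsAcyclic := by
    intro v c hc
    have hle : G.deleteEdges {s(a, b)} ≤ G := deleteEdges_le _
    have h1 := (huniq _ _ w (c.mapLe hle) hw (hc.mapLe hle) s(a, b)).1 he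
    rw [Walk.edges_mapLe_eq_edges] at h1
    have h2 := c.edges_subset_edgeSet h1
    simp at h2
  have ht : (G.deleteEdges {s(a, b)}).IsTree :=
    ⟨hconn.connected_delete_edge_of_not_isBridge hnb, hac⟩
  have h1 := ht.card_edgeFinset
  rw [← h1]
  have h2 : (G.deleteEdges {s(a, b)}).edgeFinset = G.edgeFinset.erase s(a, b) := by
    ext e
    simp [edgeSet_deleteEdges, and_comm]
  rw [h2, Finset.card_erase_of_mem (by simpa using heG)]
  have : 0 < G.edgeFinset.card := Finset.card_pos.2 ⟨s(a, b), by simpa using heG⟩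
  omega

/-- `G` consists of the cycle labelled by `vc` with rooted trees attached to it: `π x` is the index
of the root of the tree containing `x`, `h x` is the height of `x`, and `p x` its parent. -/
structure CycTree {V : Type*} (G : SimpleGraph V) (g : ℕ) (vc : ZMod g → V)
    (π : V → ZMod g) (h : V → ℕ) (p : V → V) : Prop where
  conn : G.Connected
  inj : Function.Injective vc
  adj : ∀ i, G.Adj (vc i) (vc (i + 1))
  three_le : 3 ≤ g
  root : ∀ i, π (vc i) = i
  height_root : ∀ i, h (vc i) = 0
  eq_root : ∀ x, h x = 0 → vc (π x) = x
  adj_parent : ∀ x, 0 < h x → G.Adj x (p x)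
  height_parent : ∀ x, 0 < h x → h (p x) + 1 = h x
  proj_parent : ∀ x, 0 < h x → π (p x) = π x
  cover : ∀ x y, G.Adj x y →
    (∃ i, s(x, y) = s(vc i, vc (i + 1))) ∨ (0 < h x ∧ p x = y) ∨ (0 < h y ∧ p y = x)

theorem two_ne_zero_zmod {g : ℕ} (hg : 3 ≤ g) (i : ZMod g) : i + 1 + 1 ≠ i := by
  intro h0
  have h1 : ((2 : ℕ) : ZMod g) = 0 := by
    have : i + 2 = i + 0 := by rw [add_zero]; linear_combination h0
    exact_mod_cast add_left_cancel this
  rw [ZMod.natCast_eq_zero_iff] at h1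
  exact absurd (Nat.le_of_dvd (by norm_num) h1) (by omega)

theorem exists_cycTree {V : Type*} [Fintype V] [DecidableEq V] {G : SimpleGraph V}
    [DecidableRel G.Adj] (hG : IsUnicyclic G) {g : ℕ} (hg : 3 ≤ g) {vc : ZMod g → V}
    (hvc : IsCycleLabelling G g vc) : ∃ π h p, CycTree G g vc π h p := by
  have hcard := hG.card_edgeFinset
  have hconn := hG.1
  obtain ⟨hinj, hadj⟩ := hvc
  have hne : ∀ x, {n | ∃ i, G.dist (vc i) x = n}.Nonempty := fun x => ⟨_, 0, rfl⟩
  obtain ⟨h, hh⟩ : ∃ h : V → ℕ, ∀ x, h x = sInf {n | ∃ i, G.dist (vc i) x = n} := ⟨_, fun _ => rfl⟩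
  have hex : ∀ x, ∃ i, G.dist (vc i) x = h x := fun x => by
    rw [hh]; exact Nat.sInf_mem (hne x)
  have hle : ∀ x i, h x ≤ G.dist (vc i) x := fun x i => by
    rw [hh]; exact Nat.sInf_le ⟨i, rfl⟩
  have hroot : ∀ i, h (vc i) = 0 := fun i => by
    have := hle (vc i) i; simpa using this
  have hzero : ∀ x, h x = 0 → ∃ i, vc i = x := fun x hx => by
    obtain ⟨i, hi⟩ := hex x
    rw [hx, hconn.dist_eq_zero_iff] at hi
    exact ⟨i, hi⟩
  have hpar : ∀ x, ∃ y, 0 < h x → G.Adj x y ∧ h y + 1 = h x := by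
    intro x
    by_cases hx : 0 < h x
    · obtain ⟨i, hi⟩ := hex x
      obtain ⟨w, hw⟩ := hconn.exists_walk_length_eq_dist x (vc i)
      rw [dist_comm, hi] at hw
      cases w with
      | nil => simp at hw; omega
      | @cons _ y _ ha w' =>
        refine ⟨y, fun _ => ⟨ha, ?_⟩⟩
        rw [Walk.length_cons] at hw
        have h1 := dist_le w'
        have h2 := hle y i
        rw [dist_comm] at h1
        obtain ⟨j, hj⟩ := hex y
        have h3 := hle x j
        have h4 : G.dist (vc j) x ≤ G.dist (vc j) y + G.dist y x := hconn.dist_triangle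
        rw [dist_eq_one_iff_adj.2 ha.symm] at h4
        omega
    · exact ⟨x, fun h0 => absurd h0 hx⟩
  choose p hp using hpar
  have hit : ∀ n x, h x = n → ∃ i, vc i = p^[n] x := by
    intro n
    induction n with
    | zero => intro x hx; exact hzero x hx
    | succ n ih =>
      intro x hx
      rw [Function.iterate_succ_apply]
      exact ih _ (by have := (hp x (by omega)).2; omega)
  choose! π hπ using fun x => hit (h x) x rfl
  have hπr : ∀ i, π (vc i) = i := fun i => hinj (by rw [hπ, hroot]; rfl)
  have hπp : ∀ x, 0 < h x → π (p x) = π x := fun x hx => hinj (by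
    have := (hp x hx).2
    rw [hπ, hπ, ← this, Function.iterate_succ_apply])
  refine ⟨π, h, p, hconn, hinj, hadj, hg, hπr, hroot, fun x hx => by rw [hπ, hx]; rfl,
    fun x hx => (hp x hx).1, fun x hx => (hp x hx).2, hπp, ?_⟩
  let φ : V → G.edgeSet := fun x =>
    if hx : 0 < h x then ⟨s(x, p x), (hp x hx).1⟩ else ⟨s(vc (π x), vc (π x + 1)), hadj _⟩
  have hφ : Function.Injective φ := by
    intro x y hxy
    replace hxy := congrArg Subtype.val hxy
    by_cases hx : 0 < h x <;> by_cases hy : 0 < h y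
    · simp only [φ, hx, hy, dite_true, Sym2.eq_iff] at hxy
      obtain ⟨h1, -⟩ | ⟨h1, h2⟩ := hxy
      · exact h1
      · have h3 := (hp x hx).2
        have h4 := (hp y hy).2
        rw [h2] at h3; rw [← h1] at h4; omega
    · simp only [φ, hx, hy, dite_true, dite_false, Sym2.eq_iff] at hxy
      obtain ⟨h1, -⟩ | ⟨h1, -⟩ := hxy <;> rw [h1, hroot] at hx <;> omega
    · simp only [φ, hx, hy, dite_true, dite_false, Sym2.eq_iff] at hxy
      obtain ⟨h1, -⟩ | ⟨-, h1⟩ := hxy <;> rw [← h1, hroot] at hy <;> omega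
    · simp only [φ, hx, hy, dite_false, Sym2.eq_iff] at hxy
      have e1 : vc (π x) = x := by rw [hπ, Nat.eq_zero_of_not_pos hx]; rfl
      have e2 : vc (π y) = y := by rw [hπ, Nat.eq_zero_of_not_pos hy]; rfl
      obtain ⟨h1, -⟩ | ⟨h1, h2⟩ := hxy
      · rw [← e1, ← e2, h1]
      · have h1 := hinj h1
        have h2 := hinj h2
        rw [h1] at h2
        exact absurd h2 (two_ne_zero_zmod hg _)
  have hbij : Function.Bijective φ := by
    rw [Fintype.bijective_iff_injective_and_card]
    exact ⟨hφ, by rw [← hcard, edgeFinset_card]⟩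
  intro x y hxy
  obtain ⟨z, hz⟩ := hbij.2 ⟨s(x, y), hxy⟩
  replace hz := congrArg Subtype.val hz
  by_cases h0 : 0 < h z
  · simp only [φ, h0, dite_true, Sym2.eq_iff] at hz
    obtain ⟨rfl, rfl⟩ | ⟨rfl, rfl⟩ := hz
    · exact Or.inr (Or.inl ⟨h0, rfl⟩)
    · exact Or.inr (Or.inr ⟨h0, rfl⟩)
  · simp only [φ, h0, dite_false] at hz
    exact Or.inl ⟨_, hz.symm⟩

theorem le_add_dist_of_forall_adj {V : Type*} {G : SimpleGraph V} (hc : G.Connected) (f : V → ℕ)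
    (hf : ∀ x y, G.Adj x y → f y ≤ f x + 1) (x y : V) : f y ≤ f x + G.dist x y := by
  obtain ⟨w, hw⟩ := hc.exists_walk_length_eq_dist x y
  rw [← hw]
  clear hw
  induction w with
  | nil => simp
  | cons ha w ih =>
    have := hf _ _ ha
    rw [Walk.length_cons]
    omega

/-- The distance between the vertices `a, b < g` of a cycle of length `g`. -/
def cycDist (g a b : ℕ) : ℕ := min ((a - b) + (b - a)) (g - ((a - b) + (b - a)))

theorem ZMod.val_succ_cases {g : ℕ} [NeZero g] (hg : 3 ≤ g) (i : ZMod g) :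
    (i + 1).val = i.val + 1 ∨ ((i + 1).val = 0 ∧ i.val + 1 = g) := by
  have : Fact (1 < g) := ⟨by omega⟩
  have h1 := ZMod.val_add i 1
  rw [ZMod.val_one] at h1
  have h2 := ZMod.val_lt i
  by_cases h3 : i.val + 1 = g
  · exact Or.inr ⟨by rw [h1, h3, Nat.mod_self], h3⟩
  · exact Or.inl (by rw [h1, Nat.mod_eq_of_lt (by omega)])

theorem ZMod.eq_add_natCast_of_val {g : ℕ} [NeZero g] {i j : ZMod g} {n : ℕ}
    (h : j.val = i.val + n ∨ j.val + g = i.val + n) : j = i + n := by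
  rw [← ZMod.natCast_zmod_val i, ← ZMod.natCast_zmod_val j]
  rcases h with h | h
  · exact_mod_cast congrArg (Nat.cast : ℕ → ZMod g) h
  · have := congrArg (Nat.cast : ℕ → ZMod g) h
    push_cast at this
    simpa using this

namespace CycTree

variable {V : Type*} {G : SimpleGraph V} {g : ℕ} {vc : ZMod g → V} {π : V → ZMod g} {h : V → ℕ}
  {p : V → V}

theorem neZero (H : CycTree G g vc π h p) : NeZero g := ⟨by have := H.three_le; omega⟩

theorem height_iterate (H : CycTree G g vc π h p) (n : ℕ) :
    ∀ x, n ≤ h x → h (p^[n] x) + n = h x := by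
  induction n with
  | zero => intro x _; rfl
  | succ n ih =>
    intro x hx
    have := H.height_parent x (by omega)
    have := ih (p x) (by omega)
    rw [Function.iterate_succ_apply]
    omega

theorem proj_iterate (H : CycTree G g vc π h p) (n : ℕ) :
    ∀ x, n ≤ h x → π (p^[n] x) = π x := by
  induction n with
  | zero => intro x _; rfl
  | succ n ih =>
    intro x hx
    have := H.height_parent x (by omega)
    rw [Function.iterate_succ_apply, ih (p x) (by omega), H.proj_parent x (by omega)]

theorem dist_iterate_le (H : CycTree G g vc π h p) (n : ℕ) :
    ∀ x, n ≤ h x → G.dist x (p^[n] x) ≤ n := by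
  induction n with
  | zero => intro x _; simp
  | succ n ih =>
    intro x hx
    have := H.height_parent x (by omega)
    have h1 := ih (p x) (by omega)
    have h2 : G.dist x (p^[n] (p x)) ≤ G.dist x (p x) + G.dist (p x) (p^[n] (p x)) :=
      H.conn.dist_triangle
    rw [dist_eq_one_iff_adj.2 (H.adj_parent x (by omega))] at h2
    rw [Function.iterate_succ_apply]
    omega

theorem iterate_height (H : CycTree G g vc π h p) (x : V) : p^[h x] x = vc (π x) := by
  have h1 := H.height_iterate (h x) x le_rfl
  have h2 := H.proj_iterate (h x) x le_rfl
  rw [← H.eq_root (p^[h x] x) (by omega), h2]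

theorem dist_root_self_le (H : CycTree G g vc π h p) (x : V) : G.dist x (vc (π x)) ≤ h x := by
  have := H.dist_iterate_le (h x) x le_rfl
  rwa [H.iterate_height] at this

theorem dist_add_natCast_le (H : CycTree G g vc π h p) (i : ZMod g) (n : ℕ) :
    G.dist (vc i) (vc (i + n)) ≤ n := by
  induction n with
  | zero => simp
  | succ n ih =>
    have h2 : G.dist (vc i) (vc (i + n + 1)) ≤
        G.dist (vc i) (vc (i + n)) + G.dist (vc (i + n)) (vc (i + n + 1)) := H.conn.dist_triangle
    rw [dist_eq_one_iff_adj.2 (H.adj _)] at h2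
    push_cast
    rw [← add_assoc]
    omega

theorem dist_cycle_le (H : CycTree G g vc π h p) (i j : ZMod g) :
    G.dist (vc i) (vc j) ≤ cycDist g i.val j.val := by
  have := H.neZero
  have hi := ZMod.val_lt i
  have hj := ZMod.val_lt j
  have key : ∀ (i j : ZMod g) (n : ℕ), j.val = i.val + n ∨ j.val + g = i.val + n →
      G.dist (vc i) (vc j) ≤ n := fun i j n hn => by
    rw [ZMod.eq_add_natCast_of_val hn]; exact H.dist_add_natCast_le i n
  unfold cycDist
  rw [le_min_iff]
  rcases le_total i.val j.val with hij | hij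
  · exact ⟨key _ _ _ (by omega), by rw [dist_comm]; exact key _ _ _ (by omega)⟩
  · exact ⟨by rw [dist_comm]; exact key _ _ _ (by omega), key _ _ _ (by omega)⟩

theorem dist_root (H : CycTree G g vc π h p) (s : V) (j : ZMod g) :
    G.dist s (vc j) = h s + cycDist g (π s).val j.val := by
  have := H.neZero
  apply le_antisymm
  · have h1 := H.dist_root_self_le s
    have h2 := H.dist_cycle_le (π s) j
    have h3 : G.dist s (vc j) ≤ G.dist s (vc (π s)) + G.dist (vc (π s)) (vc j) :=
      H.conn.dist_triangle
    omega
  · have := le_add_dist_of_forall_adj H.conn (fun y => h y + cycDist g (π y).val j.val) ?_ (vc j) s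
    · simp only [H.height_root, H.root] at this
      rw [dist_comm]
      simpa [cycDist] using this
    · intro x y hxy
      have hj := ZMod.val_lt j
      rcases H.cover x y hxy with ⟨i, hi⟩ | ⟨hx, rfl⟩ | ⟨hx, rfl⟩
      · have hi' := ZMod.val_lt i
        rw [Sym2.eq_iff] at hi
        rcases hi with ⟨rfl, rfl⟩ | ⟨rfl, rfl⟩ <;> simp only [H.height_root, H.root] <;>
          unfold cycDist <;> rcases ZMod.val_succ_cases H.three_le i with h1 | h1 <;> omega
      · have := H.height_parent x hx
        simp only [H.proj_parent x hx]
        omega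
      · have := H.height_parent y hx
        simp only [H.proj_parent y hx]
        omega

theorem height_le (H : CycTree G g vc π h p) (x y : V) : h y ≤ h x + G.dist x y := by
  refine le_add_dist_of_forall_adj H.conn h ?_ x y
  intro x y hxy
  rcases H.cover x y hxy with ⟨i, hi⟩ | ⟨hx, rfl⟩ | ⟨hx, rfl⟩
  · rw [Sym2.eq_iff] at hi
    rcases hi with ⟨rfl, rfl⟩ | ⟨rfl, rfl⟩ <;> simp [H.height_root]
  · have := H.height_parent x hx; omega
  · have := H.height_parent y hx; omega

end CycTree

/-- `x` is a descendant of `a` in the forest with heights `h` and parent map `p`. -/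
def Desc {V : Type*} (h : V → ℕ) (p : V → V) (a x : V) : Prop :=
  h a ≤ h x ∧ p^[h x - h a] x = a

namespace CycTree

variable {V : Type*} {G : SimpleGraph V} {g : ℕ} {vc : ZMod g → V} {π : V → ZMod g} {h : V → ℕ}
  {p : V → V}

theorem desc_self (a : V) : Desc h p a a := ⟨le_rfl, by simp⟩

theorem desc_eq_of_height_le {a x : V} (hx : Desc h p a x) (hh : h x ≤ h a) : x = a := by
  have := hx.2
  rwa [Nat.sub_eq_zero_of_le hh] at this

theorem desc_parent (H : CycTree G g vc π h p) {a x : V} (hx : Desc h p a x) (hne : x ≠ a) :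
    Desc h p a (p x) := by
  have h1 : h a < h x := lt_of_not_ge fun hh => hne (desc_eq_of_height_le hx hh)
  have h2 := H.height_parent x (by omega)
  refine ⟨by omega, ?_⟩
  have h3 := hx.2
  rw [show h x - h a = (h (p x) - h a) + 1 by omega, Function.iterate_succ_apply] at h3
  exact h3

theorem desc_of_desc_parent (H : CycTree G g vc π h p) {a x : V} (h0 : 0 < h x)
    (hx : Desc h p a (p x)) : Desc h p a x := by
  have h2 := H.height_parent x h0
  have h1 := hx.1
  refine ⟨by omega, ?_⟩
  rw [show h x - h a = (h (p x) - h a) + 1 by omega, Function.iterate_succ_apply]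
  exact hx.2

theorem desc_iterate (H : CycTree G g vc π h p) {x : V} {n : ℕ} (hn : n ≤ h x) :
    Desc h p (p^[n] x) x := by
  have := H.height_iterate n x hn
  refine ⟨by omega, ?_⟩
  rw [show h x - h (p^[n] x) = n by omega]

theorem desc_proj (H : CycTree G g vc π h p) {a x : V} (hx : Desc h p a x) : π x = π a := by
  have := H.proj_iterate (h x - h a) x (by omega)
  rw [hx.2] at this
  exact this.symm

/-- The only edge leaving the set of descendants of `a` joins `a` to its parent. -/
theorem desc_cut (H : CycTree G g vc π h p) {a x y : V} (ha : 0 < h a) (hxy : G.Adj x y)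
    (hx : Desc h p a x) (hy : ¬ Desc h p a y) : x = a ∧ y = p a := by
  have h1 := hx.1
  rcases H.cover x y hxy with ⟨i, hi⟩ | ⟨hx0, rfl⟩ | ⟨hy0, rfl⟩
  · exfalso
    rw [Sym2.eq_iff] at hi
    rcases hi with ⟨rfl, rfl⟩ | ⟨rfl, rfl⟩ <;> rw [H.height_root] at h1 <;> omega
  · by_cases hxa : x = a
    · exact ⟨hxa, by rw [hxa]⟩
    · exact absurd (H.desc_parent hx hxa) hy
  · exact absurd (H.desc_of_desc_parent hy0 hx) hy

theorem dist_le_of_desc (H : CycTree G g vc π h p) {a x : V} (hx : Desc h p a x) :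
    G.dist a x + h a ≤ h x := by
  have := H.dist_iterate_le (h x - h a) x (by omega)
  rw [hx.2, dist_comm] at this
  have := hx.1
  omega

theorem dist_of_not_desc (H : CycTree G g vc π h p) {a s x : V} (ha : 0 < h a)
    (hs : ¬ Desc h p a s) (hx : Desc h p a x) :
    G.dist s x + h (p a) = G.dist s (p a) + h x := by
  classical
  have hpa := H.height_parent a ha
  have hax := hx.1
  have h1 := H.dist_le_of_desc hx
  have h2 : G.dist s a ≤ G.dist s (p a) + G.dist (p a) a := H.conn.dist_triangle
  have h2' : G.dist s x ≤ G.dist s a + G.dist a x := H.conn.dist_triangle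
  rw [dist_eq_one_iff_adj.2 (H.adj_parent a ha).symm] at h2
  have h3 := le_add_dist_of_forall_adj H.conn
    (fun y => if Desc h p a y then G.dist s (p a) + h y - h (p a) else G.dist s y) ?_ s x
  · simp only [hs, hx, if_true, if_false, dist_self] at h3
    omega
  · have key : ∀ y z, G.Adj y z → G.dist s z ≤ G.dist s y + 1 := fun y z hyz => by
      have h4 : G.dist s z ≤ G.dist s y + G.dist y z := H.conn.dist_triangle
      rwa [dist_eq_one_iff_adj.2 hyz] at h4
    intro y z hyz
    have h5 := H.height_le y z
    rw [dist_eq_one_iff_adj.2 hyz] at h5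
    by_cases hy : Desc h p a y <;> by_cases hz : Desc h p a z <;>
      simp only [hy, hz, if_true, if_false]
    · omega
    · obtain ⟨rfl, rfl⟩ := H.desc_cut ha hyz hy hz
      omega
    · obtain ⟨rfl, rfl⟩ := H.desc_cut ha hyz.symm hz hy
      omega
    · exact key _ _ hyz

theorem dist_lt_of_desc (H : CycTree G g vc π h p) {a s x : V} (ha : 0 < h a)
    (hs : Desc h p a s) (hx : Desc h p a x) :
    G.dist s x + h (p a) + 2 ≤ G.dist s (p a) + h x := by
  have hpa := H.height_parent a ha
  have h1 := H.dist_le_of_desc hx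
  have h2 := H.dist_le_of_desc hs
  have h3 := H.height_le (p a) s
  have h4 : G.dist s x ≤ G.dist s a + G.dist a x := H.conn.dist_triangle
  rw [dist_comm] at h2 h3
  omega

theorem dist_of_proj_ne (H : CycTree G g vc π h p) {s x : V} (hsx : π s ≠ π x) :
    G.dist s x = h s + cycDist g (π s).val (π x).val + h x := by
  rcases Nat.eq_zero_or_pos (h x) with h0 | h0
  · conv_lhs => rw [← H.eq_root x h0]
    rw [H.dist_root, h0, add_zero]
  · have hd : Desc h p (p^[h x - 1] x) x := H.desc_iterate (by omega)
    have ha := H.height_iterate (h x - 1) x (by omega)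
    have hs : ¬ Desc h p (p^[h x - 1] x) s := fun hs =>
      hsx ((H.desc_proj hs).trans (H.desc_proj hd).symm)
    have h1 := H.dist_of_not_desc (by omega) hs hd
    have h2 : p (p^[h x - 1] x) = vc (π x) := by
      rw [← Function.iterate_succ_apply' p, show (h x - 1).succ = h x by omega, H.iterate_height]
    rw [h2, H.height_root, H.dist_root] at h1
    omega

theorem dist_le_of_proj_eq (H : CycTree G g vc π h p) {s x : V} (hsx : π s = π x) :
    G.dist s x ≤ h s + h x := by
  have h1 := H.dist_root_self_le s
  have h2 := H.dist_root_self_le x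
  have h3 : G.dist s x ≤ G.dist s (vc (π s)) + G.dist (vc (π s)) x := H.conn.dist_triangle
  rw [dist_comm, ← hsx] at h2
  omega

end CycTree

/-- `u 1, …, u m` is a thread hanging at `u 0 = v`, presented as a function on indices. -/
structure ThreadFun {V : Type*} [Fintype V] (G : SimpleGraph V) [DecidableRel G.Adj] (v : V)
    (u : ℕ → V) (m : ℕ) : Prop where
  zero : u 0 = v
  pos : 0 < m
  inj : ∀ a b, a ≤ m → b ≤ m → u a = u b → a = b
  adj : ∀ n, n < m → G.Adj (u n) (u (n + 1))
  deg_two : ∀ n, 0 < n → n < m → G.degree (u n) = 2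
  deg_one : G.degree (u m) = 1

theorem SFree.ne {V : Type*} {S : Set V} {t : List V} (hS : SFree S t) {u : ℕ → V}
    (hu : ∀ n (hn : n < t.length), t[n] = u (n + 1)) {s : V} (hs : s ∈ S) :
    ∀ n, 0 < n → n ≤ t.length → u n ≠ s := by
  rintro n hn0 hn rfl
  obtain ⟨k, rfl⟩ : ∃ k, n = k + 1 := ⟨n - 1, by omega⟩
  refine hS _ ?_ hs
  rw [← hu k hn]
  exact List.getElem_mem _

section Threads

variable {V : Type*} [Fintype V] {G : SimpleGraph V} [DecidableRel G.Adj]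

theorem IsThreadAt.exists_threadFun {v : V} {t : List V} (ht : IsThreadAt G v t) :
    ∃ u, ThreadFun G v u t.length ∧ ∀ n (hn : n < t.length), t[n] = u (n + 1) := by
  obtain ⟨hne, hnd, hv, -, hch, hhd, hlast, hdrop⟩ := ht
  have hpos := List.length_pos_iff.2 hne
  have hget : ∀ n (hn : n < t.length), t[n] = (v :: t).getD (n + 1) v := fun n hn => by
    simp [List.getD, hn]
  refine ⟨fun n => (v :: t).getD n v, ⟨by simp, hpos, ?_, ?_, ?_, ?_⟩, hget⟩
  · intro a b ha hb hab
    have hnd' : (v :: t).Nodup := List.nodup_cons.2 ⟨hv, hnd⟩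
    have ha' : a < (v :: t).length := by simp; omega
    have hb' : b < (v :: t).length := by simp; omega
    simp only [List.getD_eq_getElem _ _ ha', List.getD_eq_getElem _ _ hb'] at hab
    exact (hnd'.getElem_inj_iff).1 hab
  · intro n hn
    cases n with
    | zero =>
      have := hhd (t[0]) (by rw [List.head?_eq_getElem?]; simp [hpos])
      change G.Adj ((v :: t).getD 0 v) ((v :: t).getD (0 + 1) v)
      rw [← hget 0 hpos]
      exact this
    | succ n =>
      have hch' : List.IsChain G.Adj t := hch
      have := List.isChain_iff_getElem.1 hch' n (by omega)
      change G.Adj ((v :: t).getD (n + 1) v) ((v :: t).getD (n + 1 + 1) v)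
      rwa [← hget n (by omega), ← hget (n + 1) hn]
  · intro n hn0 hn
    obtain ⟨k, rfl⟩ : ∃ k, n = k + 1 := ⟨n - 1, by omega⟩
    have := hdrop (t[k]) (List.mem_iff_getElem.2 ⟨k, by simp; omega, by simp⟩)
    change G.degree ((v :: t).getD (k + 1) v) = 2
    rwa [← hget k (by omega)]
  · have h1 := hlast (t[t.length - 1]) (by rw [List.getLast?_eq_getElem?]; simp [hpos])
    have h2 := hget (t.length - 1) (by omega)
    rw [show t.length - 1 + 1 = t.length by omega] at h2
    change G.degree ((v :: t).getD t.length v) = 1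
    rwa [← h2]

namespace ThreadFun

variable {v : V} {u : ℕ → V} {m : ℕ}

theorem eq_of_adj (T : ThreadFun G v u m) {n : ℕ} (hn0 : 0 < n) (hn : n ≤ m) {z : V}
    (hz : G.Adj (u n) z) : z = u (n - 1) ∨ (n < m ∧ z = u (n + 1)) := by
  classical
  have hprev : G.Adj (u n) (u (n - 1)) := by
    have := T.adj (n - 1) (by omega)
    rw [show n - 1 + 1 = n by omega] at this
    exact this.symm
  rcases Nat.lt_or_ge n m with hnm | hnm
  · have hd := T.deg_two n hn0 hnm
    by_contra! hcon
    have hne : u (n - 1) ≠ u (n + 1) := fun he => by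
      have := T.inj _ _ (by omega) (by omega) he; omega
    have hsub : ({z, u (n - 1), u (n + 1)} : Finset V) ⊆ G.neighborFinset (u n) := by
      intro y hy
      simp only [Finset.mem_insert, Finset.mem_singleton] at hy
      rw [mem_neighborFinset]
      rcases hy with rfl | rfl | rfl
      exacts [hz, hprev, T.adj n hnm]
    have := Finset.card_le_card hsub
    rw [card_neighborFinset_eq_degree, hd, Finset.card_eq_three.2
      ⟨_, _, _, hcon.1, hcon.2 hnm, hne, rfl⟩] at this
    omega
  · have hd := T.deg_one
    rw [show m = n by omega, ← card_neighborFinset_eq_degree, Finset.card_eq_one] at hd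
    obtain ⟨y, hy⟩ := hd
    have h1 : z ∈ G.neighborFinset (u n) := by simpa using hz
    have h2 : u (n - 1) ∈ G.neighborFinset (u n) := by simpa using hprev
    rw [hy, Finset.mem_singleton] at h1 h2
    exact Or.inl (h1.trans h2.symm)

theorem dist_eq (T : ThreadFun G v u m) (hc : G.Connected) {s : V}
    (hs : ∀ n, 0 < n → n ≤ m → u n ≠ s) {n : ℕ} (hn : n ≤ m) :
    G.dist s (u n) = G.dist s v + n := by
  classical
  have key : ∀ y z, G.Adj y z → G.dist s z ≤ G.dist s y + 1 := fun y z hyz => by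
    have h4 : G.dist s z ≤ G.dist s y + G.dist y z := hc.dist_triangle
    rwa [dist_eq_one_iff_adj.2 hyz] at h4
  apply le_antisymm
  · induction n with
    | zero => rw [T.zero]; rfl
    | succ n ih =>
      have := ih (by omega)
      have := key _ _ (T.adj n (by omega))
      omega
  · obtain ⟨f, hf1, hf2⟩ : ∃ f : V → ℕ, (∀ n, 0 < n → n ≤ m → f (u n) = G.dist s v + n) ∧
        ∀ y, (∀ n, 0 < n → n ≤ m → u n ≠ y) → f y = G.dist s y := by
      refine ⟨fun y => if hy : ∃ n, 0 < n ∧ n ≤ m ∧ u n = y then G.dist s v + hy.choose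
        else G.dist s y, ?_, ?_⟩
      · intro n hn0 hn
        have hy : ∃ k, 0 < k ∧ k ≤ m ∧ u k = u n := ⟨n, hn0, hn, rfl⟩
        simp only [hy, dite_true]
        rw [T.inj _ _ hy.choose_spec.2.1 hn hy.choose_spec.2.2]
      · intro y hy
        beta_reduce
        rw [dif_neg]
        rintro ⟨n, h1, h2, h3⟩
        exact hy n h1 h2 h3
    have hf0 : f (u 0) = G.dist s v := by
      rw [hf2 _ fun n h1 h2 h3 => by have := T.inj _ _ h2 (by omega) h3; omega, T.zero]
    have hf1' : ∀ n, n ≤ m → f (u n) = G.dist s v + n := fun n hn => by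
      rcases Nat.eq_zero_or_pos n with rfl | h0
      · exact hf0
      · exact hf1 n h0 hn
    have hin : ∀ k, 0 < k → k ≤ m → ∀ z, G.Adj (u k) z → f z ≤ f (u k) + 1 ∧ f (u k) ≤ f z + 1 := by
      intro k hk0 hk z hz
      have h1 := hf1 k hk0 hk
      rcases T.eq_of_adj hk0 hk hz with rfl | ⟨h2, rfl⟩
      · have := hf1' (k - 1) (by omega)
        omega
      · have := hf1' (k + 1) (by omega)
        omega
    have h3 := le_add_dist_of_forall_adj hc f ?_ s (u n)
    · rw [hf2 s hs, hf1' n hn, SimpleGraph.dist_self] at h3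
      omega
    · intro y z hyz
      by_cases hy : ∃ k, 0 < k ∧ k ≤ m ∧ u k = y
      · obtain ⟨k, h1, h2, rfl⟩ := hy
        exact (hin k h1 h2 z hyz).1
      · by_cases hz : ∃ k, 0 < k ∧ k ≤ m ∧ u k = z
        · obtain ⟨k, h1, h2, rfl⟩ := hz
          exact (hin k h1 h2 y hyz.symm).2
        · push Not at hy hz
          rw [hf2 y hy, hf2 z hz]
          exact key _ _ hyz

theorem eq_of_eq_one {u' : ℕ → V} {m' : ℕ} (T : ThreadFun G v u m) (T' : ThreadFun G v u' m')
    (h1 : u 1 = u' 1) : ∀ n, n ≤ m → n ≤ m' ∧ u n = u' n := by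
  intro n
  induction n using Nat.strong_induction_on with
  | _ n ih =>
    intro hn
    rcases n with _ | _ | n
    · exact ⟨by omega, by rw [T.zero, T'.zero]⟩
    · exact ⟨T'.pos, h1⟩
    · obtain ⟨h2, h3⟩ := ih (n + 1) (by omega) (by omega)
      obtain ⟨-, h4⟩ := ih n (by omega) (by omega)
      have h5 := T.deg_two (n + 1) (by omega) (by omega)
      have h6 : n + 1 ≠ m' := fun he => by
        have := T'.deg_one
        rw [← he, ← h3] at this
        omega
      have h7 := T.adj (n + 1) (by omega)
      rw [h3] at h7
      rcases T'.eq_of_adj (by omega) h2 h7 with h8 | ⟨-, h8⟩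
      · simp only [Nat.add_sub_cancel] at h8
        rw [← h4] at h8
        have := T.inj _ _ (by omega) (by omega) h8
        omega
      · exact ⟨by omega, h8⟩

end ThreadFun

theorem IsThreadAt.eq_of_head_eq {v : V} {t t' : List V} (ht : IsThreadAt G v t)
    (ht' : IsThreadAt G v t') (h : t.head? = t'.head?) : t = t' := by
  obtain ⟨u, T, hu⟩ := ht.exists_threadFun
  obtain ⟨u', T', hu'⟩ := ht'.exists_threadFun
  have h1 : u 1 = u' 1 := by
    rw [← hu 0 T.pos, ← hu' 0 T'.pos]
    rw [List.head?_eq_getElem?, List.head?_eq_getElem?] at h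
    simpa [T.pos, T'.pos] using h
  have e1 := T.eq_of_eq_one T' h1
  have e2 := T'.eq_of_eq_one T h1.symm
  refine List.ext_getElem (le_antisymm (e1 _ le_rfl).1 (e2 _ le_rfl).1) fun n hn hn' => ?_
  rw [hu n hn, hu' n hn', (e1 (n + 1) hn).2]

/-- Two distinct `S`-free threads at `v` start with distinct neighbours of `v` whose distance from
each vertex of `S` is one more than that of `v`. -/
theorem exists_twins_of_not_branchResolving (hc : G.Connected) {S : Set V}
    (hS : ¬ BranchResolving G S) : ∃ v x y, x ≠ y ∧ G.Adj v x ∧ G.Adj v y ∧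
      ∀ s ∈ S, G.dist s x = G.dist s v + 1 ∧ G.dist s y = G.dist s v + 1 := by
  unfold BranchResolving at hS
  push Not at hS
  obtain ⟨v, t, t', ht, ht', hne, hf, hf'⟩ := hS
  have hf : SFree S t := fun u hu hs => hf u hs hu
  have hf' : SFree S t' := fun u hu hs => hf' u hs hu
  obtain ⟨u, T, hu⟩ := ht.exists_threadFun
  obtain ⟨u', T', hu'⟩ := ht'.exists_threadFun
  refine ⟨v, u 1, u' 1, fun he => hne (ht.eq_of_head_eq ht' ?_), ?_, ?_, fun s hs => ⟨?_, ?_⟩⟩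
  · rw [List.head?_eq_getElem?, List.head?_eq_getElem?]
    simp [T.pos, T'.pos, hu, hu', he]
  · simpa [T.zero] using T.adj 0 T.pos
  · simpa [T'.zero] using T'.adj 0 T'.pos
  · exact T.dist_eq hc (hf.ne hu hs) T.pos
  · exact T'.dist_eq hc (hf'.ne hu' hs) T'.pos

theorem edgeDist_mk {V : Type*} (G : SimpleGraph V) (s x y : V) :
    edgeDist G s s(x, y) = min (G.dist s x) (G.dist s y) := rfl

theorem IsVertexMG.branchResolving (hc : G.Connected) {S : Set V} (hS : IsVertexMG G S) :
    BranchResolving G S := by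
  by_contra hn
  obtain ⟨v, x, y, hxy, -, -, h1⟩ := exists_twins_of_not_branchResolving hc hn
  obtain ⟨s, hs, h2⟩ := hS x y hxy
  have := h1 s hs
  omega

theorem IsEdgeMG.branchResolving (hc : G.Connected) {S : Set V} (hS : IsEdgeMG G S) :
    BranchResolving G S := by
  by_contra hn
  obtain ⟨v, x, y, hxy, hx, hy, h1⟩ := exists_twins_of_not_branchResolving hc hn
  obtain ⟨s, hs, h2⟩ := hS s(v, x) hx s(v, y) hy (by
    rw [Ne, Sym2.eq_iff]
    rintro (⟨-, h3⟩ | ⟨h3, -⟩)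
    exacts [hxy h3, hy.ne h3])
  rw [edgeDist_mk, edgeDist_mk] at h2
  have := h1 s hs
  omega

end Threads

/-- `t` is an induced path that starts at `a`, ends in a leaf and contains every descendant
of `a`. -/
structure IsPendantPath {V : Type*} [Fintype V] (G : SimpleGraph V) [DecidableRel G.Adj]
    (h : V → ℕ) (p : V → V) (a : V) (t : List V) : Prop where
  head : t.head? = some a
  nodup : t.Nodup
  chain : List.IsChain G.Adj t
  deg_one : ∀ u ∈ t.getLast?, G.degree u = 1
  deg_two : ∀ u ∈ t.dropLast, G.degree u = 2
  desc : ∀ u ∈ t, Desc h p a u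
  height_lt : ∀ y, Desc h p a y → h y < h a + t.length

namespace CycTree

variable {V : Type*} {G : SimpleGraph V} {g : ℕ} {vc : ZMod g → V} {π : V → ZMod g} {h : V → ℕ}
  {p : V → V}

theorem edgeDist_of_not_desc (H : CycTree G g vc π h p) {a s x : V} (ha : 0 < h a)
    (hs : ¬ Desc h p a s) (hx : Desc h p a x) :
    edgeDist G s s(x, p x) + h (p a) + 1 = G.dist s (p a) + h x := by
  have h1 := H.dist_of_not_desc ha hs hx
  have h2 : G.dist s (p x) + h (p a) = G.dist s (p a) + h (p x) := by
    by_cases hxa : x = a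
    · rw [hxa]
    · exact H.dist_of_not_desc ha hs (H.desc_parent hx hxa)
  have h3 := H.height_parent x (by have := hx.1; omega)
  rw [edgeDist_mk]
  omega

theorem edgeDist_of_desc (H : CycTree G g vc π h p) {a s x : V} (ha : 0 < h a)
    (hs : Desc h p a s) (hx : Desc h p a x) :
    edgeDist G s s(x, p x) + h (p a) + 2 ≤ G.dist s (p a) + h x := by
  have h1 := H.dist_lt_of_desc ha hs hx
  rw [edgeDist_mk]
  omega

theorem desc_unique {a b s : V} (hh : h a = h b) (ha : Desc h p a s) (hb : Desc h p b s) :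
    a = b := by
  rw [← ha.2, ← hb.2, hh]

theorem desc_trans (H : CycTree G g vc π h p) {a c x : V} (hc : 0 < h c) (hca : p c = a)
    (hx : Desc h p c x) : Desc h p a x := by
  have h1 := H.height_parent c hc
  have h2 := hx.1
  rw [hca] at h1
  refine ⟨by omega, ?_⟩
  rw [show h x - h a = (h x - h c) + 1 by omega, Function.iterate_succ_apply', hx.2, hca]

theorem exists_child (H : CycTree G g vc π h p) {a x : V} (hx : Desc h p a x) (hne : x ≠ a) :
    ∃ c, 0 < h c ∧ p c = a ∧ Desc h p c x := by
  have h1 : h a < h x := lt_of_not_ge fun hh => hne (desc_eq_of_height_le hx hh)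
  refine ⟨p^[h x - h a - 1] x, ?_, ?_, H.desc_iterate (by omega)⟩
  · have := H.height_iterate (h x - h a - 1) x (by omega)
    omega
  · rw [← Function.iterate_succ_apply' p, show (h x - h a - 1).succ = h x - h a by omega]
    exact hx.2

theorem eq_parent_or_child (H : CycTree G g vc π h p) {a y : V} (ha : 0 < h a)
    (hy : G.Adj a y) : y = p a ∨ (0 < h y ∧ p y = a) := by
  rcases H.cover a y hy with ⟨i, hi⟩ | ⟨-, h1⟩ | h1
  · rw [Sym2.eq_iff] at hi
    rcases hi with ⟨rfl, -⟩ | ⟨rfl, -⟩ <;> rw [H.height_root] at ha <;> omega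
  · exact Or.inl h1.symm
  · exact Or.inr h1

theorem exists_branch (H : CycTree G g vc π h p) {x y : V} (hxy : x ≠ y) (hπ : π x = π y)
    (hh : h x = h y) : ∃ a b, a ≠ b ∧ 0 < h a ∧ h a = h b ∧ p a = p b ∧ Desc h p a x ∧
      Desc h p b y := by
  classical
  have hex : ∃ n, p^[n] x = p^[n] y := ⟨h x, by
    rw [H.iterate_height x]
    nth_rewrite 1 [hh]
    rw [H.iterate_height y, hπ]⟩
  have h1 := Nat.find_spec hex
  have h2 : Nat.find hex ≤ h x := Nat.find_min' hex (by
    rw [H.iterate_height x]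
    nth_rewrite 1 [hh]
    rw [H.iterate_height y, hπ])
  have h3 : Nat.find hex ≠ 0 := fun h0 => by
    rw [h0] at h1
    exact hxy h1
  have h4 := Nat.find_min hex (m := Nat.find hex - 1) (by omega)
  set n := Nat.find hex
  have h5 := H.height_iterate (n - 1) x (by omega)
  have h6 := H.height_iterate (n - 1) y (by omega)
  refine ⟨p^[n - 1] x, p^[n - 1] y, h4, by omega, by omega, ?_, H.desc_iterate (by omega),
    H.desc_iterate (by omega)⟩
  rw [← Function.iterate_succ_apply' p, ← Function.iterate_succ_apply' p,
    show (n - 1).succ = n by omega]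
  exact h1

section Fintype

variable [Fintype V] [DecidableRel G.Adj]

theorem three_le_degree (v x y z : V) (hx : G.Adj v x) (hy : G.Adj v y) (hz : G.Adj v z)
    (hxy : x ≠ y) (hxz : x ≠ z) (hyz : y ≠ z) : 3 ≤ G.degree v := by
  classical
  have h1 : ({x, y, z} : Finset V) ⊆ G.neighborFinset v := by
    intro w hw
    simp only [Finset.mem_insert, Finset.mem_singleton] at hw
    rw [mem_neighborFinset]
    rcases hw with rfl | rfl | rfl <;> assumption
  have h2 := Finset.card_le_card h1
  rwa [card_neighborFinset_eq_degree, Finset.card_eq_three.2 ⟨x, y, z, hxy, hxz, hyz, rfl⟩] at h2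

theorem three_le_degree_of_children (H : CycTree G g vc π h p) {a b : V} (ha : 0 < h a)
    (hb : 0 < h b) (hab : a ≠ b) (hp : p a = p b) : 3 ≤ G.degree (p a) := by
  have ha1 := H.height_parent a ha
  have hb1 := H.height_parent b hb
  have ha2 := H.adj_parent a ha
  have hb2 := H.adj_parent b hb
  rcases Nat.eq_zero_or_pos (h (p a)) with h0 | h0
  · have h3 := H.eq_root _ h0
    have h4 := H.adj (π (p a))
    rw [h3] at h4
    have h5 := H.height_root (π (p a) + 1)
    refine three_le_degree (p a) a b _ ha2.symm (hp ▸ hb2.symm) h4 hab ?_ ?_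
    · intro he; rw [← he] at h5; omega
    · intro he; rw [← he] at h5; omega
  · have h4 := H.adj_parent _ h0
    have h5 := H.height_parent _ h0
    refine three_le_degree (p a) a b _ ha2.symm (hp ▸ hb2.symm) h4 hab ?_ ?_
    · intro he; rw [← he] at h5; omega
    · intro he; rw [← he, hp] at h5; omega

theorem three_le_degree_root (H : CycTree G g vc π h p) {a : V} (ha : 0 < h a)
    (hp : h (p a) = 0) : 3 ≤ G.degree (p a) := by
  have h3 := H.eq_root _ hp
  set i := π (p a)
  have h4 := H.adj i
  have h5 := H.adj (i - 1)
  rw [sub_add_cancel, h3] at h5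
  rw [h3] at h4
  refine three_le_degree (p a) a _ _ (H.adj_parent a ha).symm h4 h5.symm ?_ ?_ ?_
  · intro he; rw [he, H.height_root] at ha; omega
  · intro he; rw [he, H.height_root] at ha; omega
  · intro he
    have := H.inj he
    apply two_ne_zero_zmod H.three_le (i - 1)
    rw [sub_add_cancel, this]

theorem _root_.IsPendantPath.isThreadAt (H : CycTree G g vc π h p) {a : V} {t : List V}
    (ht : IsPendantPath G h p a t) (ha : 0 < h a) (hd : 3 ≤ G.degree (p a)) :
    IsThreadAt G (p a) t := by
  have ha1 := H.height_parent a ha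
  refine ⟨?_, ht.nodup, ?_, hd, ht.chain, ?_, ht.deg_one, ht.deg_two⟩
  · rintro rfl; simpa using ht.head
  · intro hm
    have := (ht.desc _ hm).1
    omega
  · intro u hu
    rw [ht.head] at hu
    obtain rfl : a = u := by simpa using hu
    exact (H.adj_parent a ha).symm

theorem false_of_pendant_twins (H : CycTree G g vc π h p) {S : Set V} (hS : BranchResolving G S)
    {a b : V} (ha : 0 < h a) (hb : 0 < h b) (hab : a ≠ b) (hp : p a = p b) {t t' : List V}
    (ht : IsPendantPath G h p a t) (ht' : IsPendantPath G h p b t')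
    (hsa : ∀ s ∈ S, ¬ Desc h p a s) (hsb : ∀ s ∈ S, ¬ Desc h p b s) : False := by
  have hd := H.three_le_degree_of_children ha hb hab hp
  have T := ht.isThreadAt H ha hd
  have T' := ht'.isThreadAt H hb (hp ▸ hd)
  rw [← hp] at T'
  have htt : t ≠ t' := by
    rintro rfl
    have := ht.head.symm.trans ht'.head
    exact hab (by simpa using this)
  rcases hS _ t t' T T' htt with ⟨s, hs, hm⟩ | ⟨s, hs, hm⟩
  · exact hsa s hs (ht.desc s hm)
  · exact hsb s hs (ht'.desc s hm)

theorem exists_isPendantPath (H : CycTree G g vc π h p) {S : Set V} (hS : BranchResolving G S) :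
    ∀ a, 0 < h a → (∀ s ∈ S, ¬ Desc h p a s) → ∃ t, IsPendantPath G h p a t := by
  classical
  obtain ⟨M, hM⟩ : ∃ M, ∀ x, h x ≤ M :=
    ⟨∑ x, h x, fun x => Finset.single_le_sum (fun _ _ => Nat.zero_le _) (Finset.mem_univ x)⟩
  suffices hn : ∀ n a, M - h a < n → 0 < h a → (∀ s ∈ S, ¬ Desc h p a s) →
      ∃ t, IsPendantPath G h p a t from fun a => hn (M - h a + 1) a (by omega)
  intro n
  induction n with
  | zero => intro a ha; omega
  | succ n ih =>
    intro a han ha hsa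
    have ha2 := H.adj_parent a ha
    have ha1 := H.height_parent a ha
    have hchild : ∀ c, 0 < h c → p c = a → ∃ t, IsPendantPath G h p c t := fun c hc hca => by
      have h1 := H.height_parent c hc
      rw [hca] at h1
      have := hM c
      exact ih c (by omega) hc fun s hs hd => hsa s hs (H.desc_trans hc hca hd)
    by_cases hex : ∃ c, 0 < h c ∧ p c = a
    · obtain ⟨c, hc, hca⟩ := hex
      obtain ⟨t, ht⟩ := hchild c hc hca
      have h1 := H.height_parent c hc
      rw [hca] at h1
      have huniq : ∀ c', 0 < h c' → p c' = a → c' = c := by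
        intro c' hc' hca'
        by_contra hne
        obtain ⟨t', ht'⟩ := hchild c' hc' hca'
        exact H.false_of_pendant_twins hS hc' hc hne (hca'.trans hca.symm) ht' ht
          (fun s hs hd => hsa s hs (H.desc_trans hc' hca' hd))
          (fun s hs hd => hsa s hs (H.desc_trans hc hca hd))
      have hdeg : G.degree a = 2 := by
        rw [← card_neighborFinset_eq_degree, Finset.card_eq_two]
        refine ⟨p a, c, fun he => by rw [he] at ha1; omega, ?_⟩
        ext y
        simp only [mem_neighborFinset, Finset.mem_insert, Finset.mem_singleton]
        constructor
        · intro hy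
          rcases H.eq_parent_or_child ha hy with h2 | ⟨h2, h3⟩
          exacts [Or.inl h2, Or.inr (huniq y h2 h3)]
        · rintro (rfl | rfl)
          · exact ha2
          · exact hca ▸ (H.adj_parent y hc).symm
      have htne : t ≠ [] := by rintro rfl; simpa using ht.head
      have hat : a ∉ t := fun hm => by have := (ht.desc a hm).1; omega
      refine ⟨a :: t, by simp, List.nodup_cons.2 ⟨hat, ht.nodup⟩, ?_, ?_, ?_, ?_, ?_⟩
      · rw [List.isChain_cons]
        refine ⟨fun y hy => ?_, ht.chain⟩
        rw [ht.head] at hy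
        obtain rfl : c = y := by simpa using hy
        exact hca ▸ (H.adj_parent c hc).symm
      · rw [List.getLast?_cons_of_ne_nil htne]
        exact ht.deg_one
      · intro u hu
        rw [List.dropLast_cons_of_ne_nil htne, List.mem_cons] at hu
        rcases hu with rfl | hu
        exacts [hdeg, ht.deg_two u hu]
      · intro u hu
        rcases List.mem_cons.1 hu with rfl | hu
        · exact desc_self u
        · exact H.desc_trans hc hca (ht.desc u hu)
      · intro y hy
        by_cases hya : y = a
        · rw [hya]; simp
        · obtain ⟨c', hc', hca', hd⟩ := H.exists_child hy hya
          rw [huniq c' hc' hca'] at hd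
          have := ht.height_lt y hd
          rw [List.length_cons]
          omega
    · push Not at hex
      have hdeg : G.degree a = 1 := by
        rw [← card_neighborFinset_eq_degree, Finset.card_eq_one]
        refine ⟨p a, ?_⟩
        ext y
        simp only [mem_neighborFinset, Finset.mem_singleton]
        constructor
        · intro hy
          rcases H.eq_parent_or_child ha hy with h2 | ⟨h2, h3⟩
          exacts [h2, absurd h3 (hex y h2)]
        · rintro rfl
          exact ha2
      refine ⟨[a], by simp, by simp, by simp, by simpa using hdeg, by simp, ?_, ?_⟩
      · simpa using desc_self a
      · intro y hy
        by_cases hya : y = a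
        · rw [hya]; simp
        · obtain ⟨c', hc', hca', -⟩ := H.exists_child hy hya
          exact absurd hca' (hex c' hc')

theorem exists_resolving_branch (H : CycTree G g vc π h p) {S : Set V}
    (hS : BranchResolving G S) {x y : V} (hxy : x ≠ y) (hπ : π x = π y) (hh : h x = h y) :
    ∃ a b, 0 < h a ∧ 0 < h b ∧ p a = p b ∧ Desc h p a x ∧ Desc h p b y ∧ ∃ s ∈ S,
      (Desc h p a s ∧ ¬ Desc h p b s) ∨ (¬ Desc h p a s ∧ Desc h p b s) := by
  obtain ⟨a, b, hab, ha, hhab, hp, hax, hby⟩ := H.exists_branch hxy hπ hh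
  refine ⟨a, b, ha, by omega, hp, hax, hby, ?_⟩
  have hdisj : ∀ s, Desc h p a s → ¬ Desc h p b s := fun s h1 h2 =>
    hab (desc_unique hhab h1 h2)
  by_contra! hcon
  have hsa : ∀ s ∈ S, ¬ Desc h p a s := fun s hs hd => hdisj s hd ((hcon s hs).1 hd)
  have hsb : ∀ s ∈ S, ¬ Desc h p b s := fun s hs => (hcon s hs).2 (hsa s hs)
  obtain ⟨t, ht⟩ := H.exists_isPendantPath hS a ha hsa
  obtain ⟨t', ht'⟩ := H.exists_isPendantPath hS b (by omega) hsb
  exact H.false_of_pendant_twins hS ha (by omega) hab hp ht ht' hsa hsb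

theorem exists_dist_ne (H : CycTree G g vc π h p) {S : Set V}
    (hS : BranchResolving G S) {x y : V} (hxy : x ≠ y) (hπ : π x = π y) (hh : h x = h y) :
    ∃ s ∈ S, G.dist s x ≠ G.dist s y := by
  obtain ⟨a, b, ha, hb, hp, hax, hby, s, hs, h1⟩ := H.exists_resolving_branch hS hxy hπ hh
  refine ⟨s, hs, ?_⟩
  rcases h1 with ⟨h1, h2⟩ | ⟨h1, h2⟩
  · have h3 := H.dist_lt_of_desc ha h1 hax
    have h4 := H.dist_of_not_desc hb h2 hby
    rw [← hp] at h4
    omega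
  · have h3 := H.dist_lt_of_desc hb h2 hby
    have h4 := H.dist_of_not_desc ha h1 hax
    rw [← hp] at h3
    omega

theorem exists_edgeDist_ne (H : CycTree G g vc π h p) {S : Set V}
    (hS : BranchResolving G S) {x y : V} (hxy : x ≠ y) (hπ : π x = π y) (hh : h x = h y) :
    ∃ s ∈ S, edgeDist G s s(x, p x) ≠ edgeDist G s s(y, p y) := by
  obtain ⟨a, b, ha, hb, hp, hax, hby, s, hs, h1⟩ := H.exists_resolving_branch hS hxy hπ hh
  refine ⟨s, hs, ?_⟩
  rcases h1 with ⟨h1, h2⟩ | ⟨h1, h2⟩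
  · have h3 := H.edgeDist_of_desc ha h1 hax
    have h4 := H.edgeDist_of_not_desc hb h2 hby
    rw [← hp] at h4
    omega
  · have h3 := H.edgeDist_of_desc hb h2 hby
    have h4 := H.edgeDist_of_not_desc ha h1 hax
    rw [← hp] at h3
    omega

end Fintype

end CycTree

theorem cycDist_self (g a : ℕ) : cycDist g a a = 0 := by simp [cycDist]

theorem cycDist_pos {g a b : ℕ} (ha : a < g) (hb : b < g) (hab : a ≠ b) : 0 < cycDist g a b := by
  unfold cycDist; omega

theorem cycDist_triangle {g a b c : ℕ} (ha : a < g) (hb : b < g) (hc : c < g) :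
    cycDist g a c ≤ cycDist g a b + cycDist g b c := by
  unfold cycDist; omega

theorem cycDist_comm (g a b : ℕ) : cycDist g a b = cycDist g b a := by
  unfold cycDist; rw [add_comm]

theorem cycDist_val_succ {g : ℕ} [NeZero g] (hg : 3 ≤ g) (i : ZMod g) :
    cycDist g i.val (i + 1).val = 1 := by
  have := ZMod.val_lt i
  unfold cycDist
  rcases ZMod.val_succ_cases hg i with h | h <;> omega

/-- An `S`-free thread of length at least `d` hangs at `v_i`. -/
def HasFreeThread {V : Type*} [Fintype V] (G : SimpleGraph V) [DecidableRel G.Adj] {g : ℕ}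
    (vc : ZMod g → V) (S : Set V) (i : ZMod g) (d : ℕ) : Prop :=
  ∃ t, IsThreadAt G (vc i) t ∧ SFree S t ∧ d ≤ t.length

namespace CycTree

variable {V : Type*} {G : SimpleGraph V} {g : ℕ} {vc : ZMod g → V} {π : V → ZMod g} {h : V → ℕ}
  {p : V → V}

theorem edgeDist_cycle (H : CycTree G g vc π h p) (s : V) (j : ZMod g) :
    edgeDist G s s(vc j, vc (j + 1)) =
      h s + min (cycDist g (π s).val j.val) (cycDist g (π s).val (j + 1).val) := by
  rw [edgeDist_mk, H.dist_root, H.dist_root]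
  omega

theorem edgeDist_of_proj_ne (H : CycTree G g vc π h p) {s x : V} (hx : 0 < h x)
    (hsx : π s ≠ π x) :
    edgeDist G s s(x, p x) = h s + cycDist g (π s).val (π x).val + (h x - 1) := by
  have h1 := H.dist_of_proj_ne hsx
  have h2 := H.dist_of_proj_ne (s := s) (x := p x) (by rwa [H.proj_parent x hx])
  have h3 := H.height_parent x hx
  rw [H.proj_parent x hx] at h2
  rw [edgeDist_mk]
  omega

theorem edgeDist_le_of_proj_eq (H : CycTree G g vc π h p) {s x : V} (hx : 0 < h x)
    (hsx : π s = π x) : edgeDist G s s(x, p x) ≤ h s + (h x - 1) := by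
  have h2 := H.dist_le_of_proj_eq (s := s) (x := p x) (by rwa [H.proj_parent x hx])
  have h3 := H.height_parent x hx
  rw [edgeDist_mk]
  omega

theorem exists_edge_eq (H : CycTree G g vc π h p) {e : Sym2 V} (he : e ∈ G.edgeSet) :
    (∃ i, e = s(vc i, vc (i + 1))) ∨ ∃ x, 0 < h x ∧ e = s(x, p x) := by
  induction e with
  | _ x y =>
    rcases H.cover x y he with h1 | ⟨h1, rfl⟩ | ⟨h1, rfl⟩
    · exact Or.inl h1
    · exact Or.inr ⟨x, h1, rfl⟩
    · exact Or.inr ⟨y, h1, Sym2.eq_swap⟩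

theorem cycleEdge_injective (H : CycTree G g vc π h p) {i j : ZMod g}
    (hij : s(vc i, vc (i + 1)) = s(vc j, vc (j + 1))) : i = j := by
  rw [Sym2.eq_iff] at hij
  rcases hij with ⟨h1, -⟩ | ⟨h1, h2⟩
  · exact H.inj h1
  · have h1 := H.inj h1
    have h2 := H.inj h2
    rw [h1] at h2
    exact absurd h2 (two_ne_zero_zmod H.three_le j)

/-- If two objects that sit at heights `a ≥ b` in the trees at `v_i ≠ v_j` are at the same
distance from all vertices of a biactive set, then these distances are attained by paths
through the roots. -/
theorem proj_of_indistinguishable (H : CycTree G g vc π h p) {S : Set V}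
    (hS : ∃ s ∈ S, ∃ s' ∈ S, π s ≠ π s') {i j : ZMod g} (hij : i ≠ j) {a b : ℕ} (hab : b ≤ a)
    {D E : V → ℕ} (hD : ∀ s, π s ≠ i → D s = h s + cycDist g (π s).val i.val + a)
    (hD' : ∀ s, π s = i → D s ≤ h s + a)
    (hE : ∀ s, π s ≠ j → E s = h s + cycDist g (π s).val j.val + b)
    (hE' : ∀ s, π s = j → E s ≤ h s + b) (hDE : ∀ s ∈ S, D s = E s) :
    (∀ s ∈ S, π s ≠ j) ∧ (∀ s ∈ S, π s = i → D s = h s + a) ∧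
      ∀ s ∈ S, cycDist g (π s).val j.val = cycDist g (π s).val i.val + (a - b) := by
  have := H.neZero
  have hne : ∀ s ∈ S, π s ≠ j := by
    intro s hs hsj
    have h1 := hD s (by rw [hsj]; exact hij.symm)
    have h2 := hE' s hsj
    have h3 := cycDist_pos (ZMod.val_lt (π s)) (ZMod.val_lt i)
      (fun he => hij ((ZMod.val_injective g he).symm.trans hsj))
    have := hDE s hs
    omega
  have hoff : ∀ s ∈ S, π s ≠ i →
      cycDist g (π s).val j.val = cycDist g (π s).val i.val + (a - b) := by
    intro s hs hsi
    have h1 := hD s hsi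
    have h2 := hE s (hne s hs)
    have := hDE s hs
    omega
  have hon : ∀ s ∈ S, π s = i → cycDist g i.val j.val = a - b ∧ D s = h s + a := by
    intro s hs hsi
    obtain ⟨l, hl, hli⟩ : ∃ l ∈ S, π l ≠ i := by
      obtain ⟨s₁, h1, s₂, h2, h3⟩ := hS
      by_cases h4 : π s₁ = i
      · exact ⟨s₂, h2, fun h5 => h3 (h4.trans h5.symm)⟩
      · exact ⟨s₁, h1, h4⟩
    have h1 := hoff l hl hli
    have h2 := cycDist_triangle (ZMod.val_lt (π l)) (ZMod.val_lt i) (ZMod.val_lt j)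
    have h3 := hD' s hsi
    have h4 := hE s (hne s hs)
    have := hDE s hs
    rw [hsi] at h4
    omega
  refine ⟨hne, fun s hs hsi => (hon s hs hsi).2, fun s hs => ?_⟩
  by_cases hsi : π s = i
  · rw [hsi, cycDist_self, (hon s hs hsi).1, zero_add]
  · exact hoff s hs hsi

section Fintype

variable [Fintype V] [DecidableRel G.Adj]

theorem _root_.HasFreeThread.mono {S : Set V} {i : ZMod g} {d d' : ℕ}
    (ht : HasFreeThread G vc S i d) (hd : d' ≤ d) : HasFreeThread G vc S i d' := by
  obtain ⟨t, h1, h2, h3⟩ := ht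
  exact ⟨t, h1, h2, hd.trans h3⟩

theorem hasFreeThread (H : CycTree G g vc π h p) {S : Set V} (hS : BranchResolving G S) {x : V}
    (hx : 0 < h x) (hs : ∀ s ∈ S, π s = π x → h s + h x ≤ G.dist s x + 1) :
    HasFreeThread G vc S (π x) (h x) := by
  have h1 := H.height_iterate (h x - 1) x (by omega)
  have hd : Desc h p (p^[h x - 1] x) x := H.desc_iterate (by omega)
  have h2 : p (p^[h x - 1] x) = vc (π x) := by
    rw [← Function.iterate_succ_apply' p, show (h x - 1).succ = h x by omega, H.iterate_height]
  have h3 := H.proj_iterate (h x - 1) x (by omega)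
  set a := p^[h x - 1] x
  have hsa : ∀ s ∈ S, ¬ Desc h p a s := by
    intro s hsS hda
    have h4 := H.desc_proj hda
    have h5 := H.dist_lt_of_desc (by omega) hda hd
    have h6 := hs s hsS (h4.trans h3)
    rw [h2, H.height_root, ← h3, ← h4] at h5
    have := H.dist_root_self_le s
    omega
  obtain ⟨t, ht⟩ := H.exists_isPendantPath hS a (by omega) hsa
  have h7 := ht.isThreadAt H (by omega) (H.three_le_degree_root (by omega)
    (by rw [h2, H.height_root]))
  have := ht.height_lt x hd
  exact ⟨t, h2 ▸ h7, fun u hu hus => hsa u hus (ht.desc u hu), by omega⟩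

theorem not_mem_range_of_threadFun (H : CycTree G g vc π h p) {i : ZMod g} {u : ℕ → V} {m : ℕ}
    (T : ThreadFun G (vc i) u m) {n : ℕ} (hn : 0 < n) (hnm : n ≤ m) (j : ZMod g) :
    u n ≠ vc j := by
  obtain ⟨k, hk⟩ : ∃ k, n + k = m := ⟨m - n, by omega⟩
  induction k generalizing n j with
  | zero =>
    intro he
    have h1 := H.adj j
    have h2 := H.adj (j - 1)
    rw [sub_add_cancel] at h2
    rw [← he] at h1 h2
    have h3 : vc (j + 1) = vc (j - 1) := by
      rcases T.eq_of_adj hn hnm h1 with h4 | ⟨h4, -⟩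
      · rcases T.eq_of_adj hn hnm h2.symm with h5 | ⟨h5, -⟩
        · exact h4.trans h5.symm
        · omega
      · omega
    apply two_ne_zero_zmod H.three_le (j - 1)
    rw [sub_add_cancel, H.inj h3]
  | succ k ih =>
    intro he
    have h1 := H.adj j
    have h2 := H.adj (j - 1)
    rw [sub_add_cancel] at h2
    rw [← he] at h1 h2
    rcases T.eq_of_adj hn hnm h1 with h4 | ⟨-, h4⟩
    · rcases T.eq_of_adj hn hnm h2.symm with h5 | ⟨-, h5⟩
      · apply two_ne_zero_zmod H.three_le (j - 1)
        rw [sub_add_cancel, H.inj (h4.trans h5.symm)]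
      · exact ih (by omega) (by omega) _ (by omega) h5.symm
    · exact ih (by omega) (by omega) _ (by omega) h4.symm

theorem proj_threadFun (H : CycTree G g vc π h p) {i : ZMod g} {u : ℕ → V} {m : ℕ}
    (T : ThreadFun G (vc i) u m) : ∀ n, n ≤ m → π (u n) = i := by
  intro n
  induction n with
  | zero => intro _; rw [T.zero, H.root]
  | succ n ih =>
    intro hn
    have h1 := ih (by omega)
    rcases H.cover _ _ (T.adj n (by omega)) with ⟨j, hj⟩ | ⟨h2, h3⟩ | ⟨h2, h3⟩
    · rw [Sym2.eq_iff] at hj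
      rcases hj with ⟨-, h2⟩ | ⟨-, h2⟩
      exacts [absurd h2 (H.not_mem_range_of_threadFun T (by omega) hn _),
        absurd h2 (H.not_mem_range_of_threadFun T (by omega) hn _)]
    · rw [← h3, H.proj_parent _ h2, h1]
    · rw [← H.proj_parent _ h2, h3, h1]

theorem _root_.HasFreeThread.exists_threadFun (H : CycTree G g vc π h p) {S : Set V}
    {i : ZMod g} {d : ℕ} (ht : HasFreeThread G vc S i d) : ∃ u m, d ≤ m ∧
      ThreadFun G (vc i) u m ∧ ∀ s ∈ S, ∀ n, n ≤ m →
        G.dist s (u n) = h s + cycDist g (π s).val i.val + n := by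
  obtain ⟨t, ht, hf, hd⟩ := ht
  obtain ⟨u, T, hu⟩ := ht.exists_threadFun
  refine ⟨u, _, hd, T, fun s hs n hn => ?_⟩
  rw [T.dist_eq H.conn (hf.ne hu hs) hn, H.dist_root]

theorem isVertexMG_iff (H : CycTree G g vc π h p) {S : Set V} (hS : BranchResolving G S)
    (hb : ∃ s ∈ S, ∃ s' ∈ S, π s ≠ π s') :
    IsVertexMG G S ↔ ¬ ∃ i j d, i ≠ j ∧ (d = 0 ∨ HasFreeThread G vc S i d) ∧
      ∀ s ∈ S, cycDist g (π s).val j.val = cycDist g (π s).val i.val + d := by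
  constructor
  · rintro hMG ⟨i, j, d, hij, hd, heq⟩
    obtain ⟨x, hx, hxd⟩ : ∃ x, π x = i ∧ ∀ s ∈ S,
        G.dist s x = h s + cycDist g (π s).val i.val + d := by
      rcases hd with rfl | hd
      · exact ⟨vc i, H.root i, fun s _ => H.dist_root s i⟩
      · obtain ⟨u, m, hm, T, hu⟩ := hd.exists_threadFun H
        exact ⟨u d, H.proj_threadFun T d hm, fun s hs => hu s hs d hm⟩
    obtain ⟨s, hs, hne⟩ := hMG x (vc j) (by
      rintro rfl
      rw [H.root] at hx
      exact hij hx.symm)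
    rw [hxd s hs, H.dist_root, heq s hs] at hne
    omega
  · intro hN
    by_contra hMG
    unfold IsVertexMG at hMG
    push Not at hMG
    obtain ⟨x, y, hxy, heq⟩ := hMG
    have hπ : π x ≠ π y := by
      intro hπ
      obtain ⟨s, hs, hsx⟩ : ∃ s ∈ S, π s ≠ π x := by
        obtain ⟨s₁, h1, s₂, h2, h3⟩ := hb
        by_cases h4 : π s₁ = π x
        · exact ⟨s₂, h2, fun h5 => h3 (h4.trans h5.symm)⟩
        · exact ⟨s₁, h1, h4⟩
      have h1 := H.dist_of_proj_ne hsx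
      have h2 := H.dist_of_proj_ne (hπ ▸ hsx)
      rw [heq s hs, h2, hπ] at h1
      obtain ⟨s', hs', h3⟩ := H.exists_dist_ne hS hxy hπ (by omega)
      exact h3 (heq s' hs')
    wlog hh : h y ≤ h x generalizing x y
    · exact this y x hxy.symm (fun s hs => (heq s hs).symm) hπ.symm (by omega)
    obtain ⟨-, h1, h2⟩ := H.proj_of_indistinguishable hb hπ hh
      (fun s => H.dist_of_proj_ne) (fun s => H.dist_le_of_proj_eq)
      (fun s => H.dist_of_proj_ne) (fun s => H.dist_le_of_proj_eq) heq
    refine hN ⟨π x, π y, h x - h y, hπ, ?_, h2⟩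
    rcases Nat.eq_zero_or_pos (h x) with h0 | h0
    · left; omega
    · right
      refine (H.hasFreeThread hS h0 fun s hs hsx => ?_).mono (Nat.sub_le _ _)
      rw [h1 s hs hsx]
      omega

theorem isEdgeMG_iff (H : CycTree G g vc π h p) {S : Set V} (hS : BranchResolving G S)
    (hb : ∃ s ∈ S, ∃ s' ∈ S, π s ≠ π s') :
    IsEdgeMG G S ↔ ¬ ((∃ i j : ZMod g, i ≠ j ∧ ∀ s ∈ S,
        min (cycDist g (π s).val i.val) (cycDist g (π s).val (i + 1).val) =
        min (cycDist g (π s).val j.val) (cycDist g (π s).val (j + 1).val)) ∨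
      (∃ i j : ZMod g, ∃ d, 0 < d ∧ HasFreeThread G vc S i d ∧ ∀ s ∈ S,
        min (cycDist g (π s).val j.val) (cycDist g (π s).val (j + 1).val) + 1 =
        cycDist g (π s).val i.val + d) ∨
      ∃ i j d, i ≠ j ∧ HasFreeThread G vc S i (d + 1) ∧ HasFreeThread G vc S j 1 ∧
        ∀ s ∈ S, cycDist g (π s).val j.val = cycDist g (π s).val i.val + d) := by
  have := H.neZero
  have hex : ∀ i, ∃ s ∈ S, π s ≠ i := fun i => by
    obtain ⟨s₁, h1, s₂, h2, h3⟩ := hb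
    by_cases h4 : π s₁ = i
    · exact ⟨s₂, h2, fun h5 => h3 (h4.trans h5.symm)⟩
    · exact ⟨s₁, h1, h4⟩
  constructor
  · rintro hMG (⟨i, j, hij, heq⟩ | ⟨i, j, d, hd, ht, heq⟩ | ⟨i, j, d, hij, ht, ht', heq⟩)
    · obtain ⟨s, hs, hne⟩ := hMG s(vc i, vc (i + 1)) (H.adj i)
        s(vc j, vc (j + 1)) (H.adj j) fun he => hij (H.cycleEdge_injective he)
      rw [H.edgeDist_cycle, H.edgeDist_cycle, heq s hs] at hne
      exact hne rfl
    · obtain ⟨u, m, hm, T, hu⟩ := ht.exists_threadFun H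
      obtain ⟨n, rfl⟩ : ∃ n, d = n + 1 := ⟨d - 1, by omega⟩
      obtain ⟨s, hs, hne⟩ := hMG s(u n, u (n + 1)) (T.adj n (by omega))
        s(vc j, vc (j + 1)) (H.adj j) (by
        rw [Ne, Sym2.eq_iff]
        rintro (⟨-, h1⟩ | ⟨-, h1⟩)
        exacts [H.not_mem_range_of_threadFun T (by omega) hm _ h1,
          H.not_mem_range_of_threadFun T (by omega) hm _ h1])
      rw [H.edgeDist_cycle, edgeDist_mk, hu s hs n (by omega), hu s hs (n + 1) hm] at hne
      have := heq s hs
      omega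
    · obtain ⟨u, m, hm, T, hu⟩ := ht.exists_threadFun H
      obtain ⟨u', m', hm', T', hu'⟩ := ht'.exists_threadFun H
      obtain ⟨s, hs, hne⟩ := hMG s(u d, u (d + 1)) (T.adj d (by omega))
        s(u' 0, u' (0 + 1)) (T'.adj 0 (by omega)) (by
        rw [Ne, Sym2.eq_iff]
        rintro (⟨h1, -⟩ | ⟨h1, -⟩)
        all_goals
          have := congrArg π h1
          rw [H.proj_threadFun T _ (by omega), H.proj_threadFun T' _ (by omega)] at this
          exact hij this)
      rw [edgeDist_mk, edgeDist_mk, hu s hs d (by omega), hu s hs (d + 1) hm,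
        hu' s hs 0 (by omega), hu' s hs (0 + 1) (by omega)] at hne
      have := heq s hs
      omega
  · intro hN
    by_contra hMG
    unfold IsEdgeMG at hMG
    push Not at hMG
    obtain ⟨e, he, f, hf, hef, heq⟩ := hMG
    have hmixed : ∀ i x, 0 < h x →
        (∀ s ∈ S, edgeDist G s s(x, p x) = edgeDist G s s(vc i, vc (i + 1))) → False := by
      intro j x hx heq
      have hoff : ∀ s ∈ S, π s ≠ π x →
          min (cycDist g (π s).val j.val) (cycDist g (π s).val (j + 1).val) + 1 =
          cycDist g (π s).val (π x).val + h x := by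
        intro s hs hsx
        have h1 := heq s hs
        rw [H.edgeDist_cycle, H.edgeDist_of_proj_ne hx hsx] at h1
        omega
      have hon : ∀ s ∈ S, π s = π x →
          min (cycDist g (π x).val j.val) (cycDist g (π x).val (j + 1).val) + 1 = h x := by
        intro s hs hsx
        have h1 := heq s hs
        have h2 := H.edgeDist_le_of_proj_eq hx hsx
        rw [H.edgeDist_cycle, hsx] at h1
        obtain ⟨l, hl, hlx⟩ := hex (π x)
        have h3 := hoff l hl hlx
        have h4 := cycDist_triangle (ZMod.val_lt (π l)) (ZMod.val_lt (π x)) (ZMod.val_lt j)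
        have h5 := cycDist_triangle (ZMod.val_lt (π l)) (ZMod.val_lt (π x)) (ZMod.val_lt (j + 1))
        omega
      refine hN (Or.inr (Or.inl ⟨π x, j, h x, hx, H.hasFreeThread hS hx fun s hs hsx => ?_,
        fun s hs => ?_⟩))
      · have h1 := heq s hs
        have h2 := hon s hs hsx
        rw [H.edgeDist_cycle, hsx, edgeDist_mk] at h1
        omega
      · by_cases hsx : π s = π x
        · rw [hsx, cycDist_self, zero_add, hon s hs hsx]
        · exact hoff s hs hsx
    have htree : ∀ x y, 0 < h x → 0 < h y → x ≠ y → h y ≤ h x →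
        (∀ s ∈ S, edgeDist G s s(x, p x) = edgeDist G s s(y, p y)) → False := by
      intro x y hx hy hxy hh heq
      have hπ : π x ≠ π y := by
        intro hπ
        obtain ⟨s, hs, hsx⟩ := hex (π x)
        have h1 := H.edgeDist_of_proj_ne hx hsx
        have h2 := H.edgeDist_of_proj_ne hy (hπ ▸ hsx)
        rw [heq s hs, h2, hπ] at h1
        obtain ⟨s', hs', h3⟩ := H.exists_edgeDist_ne hS hxy hπ (by omega)
        exact h3 (heq s' hs')
      obtain ⟨h0, h1, h2⟩ := H.proj_of_indistinguishable hb hπ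
        (show h y - 1 ≤ h x - 1 by omega)
        (fun s => H.edgeDist_of_proj_ne hx) (fun s => H.edgeDist_le_of_proj_eq hx)
        (fun s => H.edgeDist_of_proj_ne hy) (fun s => H.edgeDist_le_of_proj_eq hy) heq
      refine hN (Or.inr (Or.inr ⟨π x, π y, h x - 1 - (h y - 1), hπ,
        (H.hasFreeThread hS hx fun s hs hsx => ?_).mono (by omega),
        (H.hasFreeThread hS hy fun s hs hsy => absurd hsy (h0 s hs)).mono hy, h2⟩))
      have h3 := h1 s hs hsx
      rw [edgeDist_mk] at h3
      omega
    rcases H.exists_edge_eq he with ⟨i, rfl⟩ | ⟨x, hx, rfl⟩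
    · rcases H.exists_edge_eq hf with ⟨j, rfl⟩ | ⟨y, hy, rfl⟩
      · refine hN (Or.inl ⟨i, j, fun hij => hef (by rw [hij]), fun s hs => ?_⟩)
        have h1 := heq s hs
        rw [H.edgeDist_cycle, H.edgeDist_cycle] at h1
        omega
      · exact hmixed i y hy fun s hs => (heq s hs).symm
    · rcases H.exists_edge_eq hf with ⟨j, rfl⟩ | ⟨y, hy, rfl⟩
      · exact hmixed j x hx heq
      · have hxy : x ≠ y := by rintro rfl; exact hef rfl
        rcases le_total (h y) (h x) with hh | hh
        · exact htree x y hx hy hxy hh heq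
        · exact htree y x hy hx hxy.symm hh fun s hs => (heq s hs).symm

end Fintype

theorem _root_.IsVertexMG.exists_proj_ne (H : CycTree G g vc π h p) {S : Set V}
    (hS : IsVertexMG G S) : ∃ s ∈ S, ∃ s' ∈ S, π s ≠ π s' := by
  have := H.neZero
  by_contra! hcon
  obtain ⟨i, hi⟩ : ∃ i, ∀ s ∈ S, π s = i := by
    rcases S.eq_empty_or_nonempty with rfl | ⟨s, hs⟩
    · exact ⟨0, by simp⟩
    · exact ⟨π s, fun s' hs' => hcon s' hs' s hs⟩
  obtain ⟨s, hs, hne⟩ := hS (vc (i + 1)) (vc (i - 1)) fun he => by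
    apply two_ne_zero_zmod H.three_le (i - 1)
    rw [sub_add_cancel, H.inj he]
  have h2 := cycDist_val_succ H.three_le (i - 1)
  rw [sub_add_cancel, cycDist_comm] at h2
  rw [H.dist_root, H.dist_root, hi s hs, cycDist_val_succ H.three_le, h2] at hne
  exact hne rfl

theorem _root_.IsEdgeMG.exists_proj_ne (H : CycTree G g vc π h p) {S : Set V}
    (hS : IsEdgeMG G S) : ∃ s ∈ S, ∃ s' ∈ S, π s ≠ π s' := by
  by_contra! hcon
  obtain ⟨i, hi⟩ : ∃ i, ∀ s ∈ S, π s = i := by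
    rcases S.eq_empty_or_nonempty with rfl | ⟨s, hs⟩
    · exact ⟨0, by simp⟩
    · exact ⟨π s, fun s' hs' => hcon s' hs' s hs⟩
  obtain ⟨s, hs, hne⟩ := hS s(vc i, vc (i + 1)) (H.adj i)
      s(vc (i - 1), vc (i - 1 + 1)) (H.adj (i - 1)) fun he => by
    have := H.cycleEdge_injective he
    apply two_ne_zero_zmod H.three_le (i - 1)
    rw [sub_add_cancel, ← this]
    nth_rewrite 1 [this]
    rw [sub_add_cancel]
  rw [H.edgeDist_cycle, H.edgeDist_cycle, hi s hs, sub_add_cancel, cycDist_self] at hne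
  simp at hne

end CycTree

/-- The set `A` of residues modulo `g` contains `0` and has largest element `k`, where `k` is the
length of a shortest arc that covers `A`. -/
structure IsTightArc (g : ℕ) (A : Set ℕ) (k : ℕ) : Prop where
  zero_mem : 0 ∈ A
  mem : k ∈ A
  le : ∀ a ∈ A, a ≤ k
  lt : k < g
  pos : 0 < k
  le_of_arc : ∀ c m, c < g → m < g →
    (∀ a ∈ A, (c ≤ a ∧ a - c ≤ m) ∨ (a < c ∧ a + g - c ≤ m)) → k ≤ m

namespace IsTightArc

variable {g k : ℕ} {A : Set ℕ}

theorem ncard_eq_two_iff (hA : IsTightArc g A k) : A.ncard = 2 ↔ ∀ a ∈ A, a = 0 ∨ a = k := by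
  have hsub : ({0, k} : Set ℕ) ⊆ A := by
    rintro a (rfl | rfl)
    exacts [hA.zero_mem, hA.mem]
  have hcard : ({0, k} : Set ℕ).ncard = 2 := Set.ncard_pair hA.pos.ne
  have hfin : A.Finite := (Set.finite_Iic k).subset hA.le
  constructor
  · intro h a ha
    have := Set.eq_of_subset_of_ncard_le hsub (by omega) hfin
    rw [← this] at ha
    exact ha
  · intro h
    rw [← hcard]
    exact congrArg Set.ncard (Set.Subset.antisymm h hsub)

theorem two_mul_le (hA : IsTightArc g A k) (h : ∀ a ∈ A, a = 0 ∨ a = k) : 2 * k ≤ g := by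
  have h1 := hA.pos
  have h2 := hA.lt
  have := hA.le_of_arc k (g - k) h2 (by omega) fun a ha => by
    rcases h a ha with rfl | rfl <;> omega
  omega

end IsTightArc

theorem cycDist_zero (g a : ℕ) : cycDist g a 0 = min a (g - a) := by simp [cycDist]

theorem min_cycDist_of_le {g a b : ℕ} (hab : a ≤ b) (hb : b < g) :
    min (cycDist g a b) (cycDist g a (b + 1)) = min (b - a) (g - 1 - (b - a)) := by
  obtain ⟨c, rfl⟩ := Nat.exists_eq_add_of_le hab
  unfold cycDist
  omega

theorem min_cycDist_of_lt {g a b : ℕ} (hab : b < a) (ha : a < g) :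
    min (cycDist g a b) (cycDist g a (b + 1)) = min (a - b - 1) (g - (a - b)) := by
  obtain ⟨c, rfl⟩ := Nat.exists_eq_add_of_lt hab
  unfold cycDist
  omega

theorem exists_offset {g i l : ℕ} (hi : i < g) (hl : l < g) :
    ∃ t < g, l = i + t ∨ l + g = i + t := by
  rcases le_total i l with h | h
  · exact ⟨l - i, by omega, by omega⟩
  · rcases h.eq_or_lt with rfl | h
    · exact ⟨0, by omega, by omega⟩
    · exact ⟨l + g - i, by omega, by omega⟩

theorem cycDist_offset {g i j l J t : ℕ} (hj : j < g) (hl : l < g)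
    (hJ : J < g) (ht : t < g) (hjJ : j = i + J ∨ j + g = i + J)
    (hlt : l = i + t ∨ l + g = i + t) : cycDist g l j = cycDist g t J := by
  unfold cycDist; omega

theorem cycDist_offset_zero {g i l t : ℕ} (hi : i < g) (hl : l < g) (ht : t < g)
    (hlt : l = i + t ∨ l + g = i + t) : cycDist g l i = cycDist g t 0 :=
  cycDist_offset hi hl (by omega) ht (Or.inl rfl) hlt

theorem min_cycDist_offset {g i j l J t : ℕ} (hj : j < g) (hl : l < g)
    (hJ : J < g) (ht : t < g) (hjJ : j = i + J ∨ j + g = i + J)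
    (hlt : l = i + t ∨ l + g = i + t) :
    min (cycDist g l j) (cycDist g l (j + 1)) = min (cycDist g t J) (cycDist g t (J + 1)) := by
  rcases Nat.lt_or_ge j l with h | h <;> rcases Nat.lt_or_ge J t with h' | h'
  · rw [min_cycDist_of_lt h hl, min_cycDist_of_lt h' ht]; omega
  · rw [min_cycDist_of_lt h hl, min_cycDist_of_le h' hJ]; omega
  · rw [min_cycDist_of_le h hj, min_cycDist_of_lt h' ht]; omega
  · rw [min_cycDist_of_le h hj, min_cycDist_of_le h' hJ]; omega

theorem offset_cases_vertex {g t J d : ℕ} (ht : t < g) (hJ : J < g) (hd : 0 < d)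
    (heq : cycDist g t J = cycDist g t 0 + d) :
    (d = J ∧ 2 * J ≤ g ∧ (t = 0 ∨ g - t + J ≤ g / 2)) ∨
    (d = g - J ∧ 2 * (g - J) ≤ g ∧ t + (g - J) ≤ g / 2) ∨
    (d < J ∧ d < g - J ∧ (2 * t + d = J ∨ 2 * t = g + J + d)) := by
  rw [cycDist_zero] at heq
  obtain ⟨q, hq⟩ : ∃ q, q = g / 2 := ⟨_, rfl⟩
  rw [← hq]
  rcases le_total t J with h | h
  · have e : cycDist g t J = min (J - t) (g - (J - t)) := by simp only [cycDist]; omega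
    rw [e] at heq
    clear e
    rcases le_total (J - t) (g - (J - t)) with h₁ | h₁ <;> rcases le_total t (g - t) with h₂ | h₂ <;>
      simp only [min_eq_left, min_eq_right, h₁, h₂] at heq <;> omega
  · have e : cycDist g t J = min (t - J) (g - (t - J)) := by simp only [cycDist]; omega
    rw [e] at heq
    clear e
    rcases le_total (t - J) (g - (t - J)) with h₁ | h₁ <;> rcases le_total t (g - t) with h₂ | h₂ <;>
      simp only [min_eq_left, min_eq_right, h₁, h₂] at heq <;> omega

theorem offset_cases_edge {g t J d : ℕ} (ht : t < g) (hJ : J < g) (hd : 0 < d)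
    (heq : min (cycDist g t J) (cycDist g t (J + 1)) + 1 = cycDist g t 0 + d) :
    (d = J + 1 ∧ 2 * J + 1 ≤ g ∧ (t = 0 ∨ g - t + J ≤ (g - 1) / 2)) ∨
    (d = g - J ∧ 2 * (g - J) ≤ g + 1 ∧ t + (g - J) ≤ (g + 1) / 2) ∨
    (d < J + 1 ∧ d < g - J ∧ (2 * t + d = J + 1 ∨ 2 * t = g + J + d)) := by
  rw [cycDist_zero] at heq
  rcases Nat.lt_or_ge J t with h | h
  · rw [min_cycDist_of_lt h ht] at heq; omega
  · rw [min_cycDist_of_le h hJ] at heq; omega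

namespace IsTightArc

variable {g k : ℕ} {A : Set ℕ} {thr : ℕ → ℕ → Prop}

theorem eq_half_of_cycDist_eq (hA : IsTightArc g A k) {i j : ℕ} (hi : i < g) (hj : j < g)
    (hij : i ≠ j) (heq : ∀ l ∈ A, cycDist g l j = cycDist g l i) :
    (∀ a ∈ A, a = 0 ∨ a = k) ∧ Even g ∧ k = g / 2 := by
  have h0 : i + j = g := by
    have := heq 0 hA.zero_mem
    unfold cycDist at this
    omega
  have h1 : ∀ a ∈ A, a = 0 ∨ 2 * a = g := fun a ha => by
    have h2 := heq a ha
    have h3 := hA.le a ha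
    have h4 := hA.lt
    unfold cycDist at h2
    omega
  have h2 := h1 k hA.mem
  have h3 := hA.pos
  refine ⟨fun a ha => ?_, ⟨g / 2, by omega⟩, by omega⟩
  have := h1 a ha
  omega

/-- Solutions with all of `A` on geodesics from `i` to `j`, or with `A` consisting of two
points. -/
theorem cases_of_cycDist_add (hA : IsTightArc g A k) {i j d : ℕ} (hi : i < g) (hj : j < g)
    (hd : 0 < d) (heq : ∀ l ∈ A, cycDist g l j = cycDist g l i + d) :
    (k ≤ g / 2 - 1 ∧ ((k ≤ i ∧ i ≤ g / 2 - 1) ∨ ((g + 1) / 2 + k + 1 ≤ i ∧ i ≤ g - 1) ∨ i = 0)) ∨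
    ((∀ a ∈ A, a = 0 ∨ a = k) ∧ Even g ∧ k + d = g / 2 ∧ i ≤ k ∧ j = g / 2 + k - i) := by
  obtain ⟨J, hJ, hjJ⟩ := exists_offset hi hj
  have key : ∀ l ∈ A, ∃ t < g, (l = i + t ∨ l + g = i + t) ∧
      ((d = J ∧ 2 * J ≤ g ∧ (t = 0 ∨ g - t + J ≤ g / 2)) ∨
      (d = g - J ∧ 2 * (g - J) ≤ g ∧ t + (g - J) ≤ g / 2) ∨
      (d < J ∧ d < g - J ∧ (2 * t + d = J ∨ 2 * t = g + J + d))) := by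
    intro l hl
    have hlg : l < g := (hA.le l hl).trans_lt hA.lt
    obtain ⟨t, ht, hlt⟩ := exists_offset hi hlg
    have h1 := heq l hl
    rw [cycDist_offset hj hlg hJ ht hjJ hlt, cycDist_offset_zero hi hlg ht hlt] at h1
    exact ⟨t, ht, hlt, offset_cases_vertex ht hJ hd h1⟩
  have hk := hA.lt
  have hk0 := hA.pos
  obtain ⟨t₀, ht₀, hl₀, hc₀⟩ := key 0 hA.zero_mem
  obtain ⟨t₁, ht₁, hl₁, hc₁⟩ := key k hA.mem
  by_cases h1 : d = J ∧ 2 * J ≤ g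
  · left
    have h2 : k ≤ g / 2 - d := by
      obtain ⟨c, hc, hci⟩ := exists_offset (i := g / 2 - d) (l := i) (by omega) hi
      refine hA.le_of_arc c _ hc (by omega) fun a ha => ?_
      obtain ⟨t, ht, hl, hc⟩ := key a ha
      have := hA.le a ha
      omega
    omega
  · by_cases h3 : d = g - J
    · left
      have h2 : k ≤ g / 2 - d := by
        refine hA.le_of_arc i _ hi (by omega) fun a ha => ?_
        obtain ⟨t, ht, hl, hc⟩ := key a ha
        have := hA.le a ha
        omega
      omega
    · right
      have h4 : ∀ a ∈ A, a = 0 ∨ a = k := fun a ha => by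
        obtain ⟨t, ht, hl, hc⟩ := key a ha
        have := hA.le a ha
        omega
      have h5 := hA.two_mul_le h4
      refine ⟨h4, ?_, ?_, ?_, ?_⟩
      · rw [Nat.even_iff]; omega
      all_goals omega

theorem cases_of_edge (hA : IsTightArc g A k) {i j d : ℕ} (hi : i < g) (hj : j < g)
    (hd : 0 < d)
    (heq : ∀ l ∈ A, min (cycDist g l j) (cycDist g l (j + 1)) + 1 = cycDist g l i + d) :
    (k ≤ (g + 1) / 2 - 1 ∧ ((k ≤ i ∧ i ≤ (g + 1) / 2 - 1) ∨
      (g / 2 + k + 1 ≤ i ∧ i ≤ g - 1) ∨ i = 0)) ∨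
    ((∀ a ∈ A, a = 0 ∨ a = k) ∧ ¬ Even g ∧ k + d = g / 2 + 1 ∧ i ≤ k) := by
  obtain ⟨J, hJ, hjJ⟩ := exists_offset hi hj
  have key : ∀ l ∈ A, ∃ t < g, (l = i + t ∨ l + g = i + t) ∧
      ((d = J + 1 ∧ 2 * J + 1 ≤ g ∧ (t = 0 ∨ g - t + J ≤ (g - 1) / 2)) ∨
      (d = g - J ∧ 2 * (g - J) ≤ g + 1 ∧ t + (g - J) ≤ (g + 1) / 2) ∨
      (d < J + 1 ∧ d < g - J ∧ (2 * t + d = J + 1 ∨ 2 * t = g + J + d))) := by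
    intro l hl
    have hlg : l < g := (hA.le l hl).trans_lt hA.lt
    obtain ⟨t, ht, hlt⟩ := exists_offset hi hlg
    have h1 := heq l hl
    rw [min_cycDist_offset hj hlg hJ ht hjJ hlt, cycDist_offset_zero hi hlg ht hlt] at h1
    exact ⟨t, ht, hlt, offset_cases_edge ht hJ hd h1⟩
  have hk := hA.lt
  have hk0 := hA.pos
  obtain ⟨t₀, ht₀, hl₀, hc₀⟩ := key 0 hA.zero_mem
  obtain ⟨t₁, ht₁, hl₁, hc₁⟩ := key k hA.mem
  by_cases h1 : d = J + 1 ∧ 2 * J + 1 ≤ g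
  · left
    have h2 : k ≤ (g - 1) / 2 - J := by
      obtain ⟨c, hc, hci⟩ := exists_offset (i := (g - 1) / 2 - J) (l := i) (by omega) hi
      refine hA.le_of_arc c _ hc (by omega) fun a ha => ?_
      obtain ⟨t, ht, hl, hc⟩ := key a ha
      have := hA.le a ha
      omega
    omega
  · by_cases h3 : d = g - J
    · left
      have h2 : k ≤ (g + 1) / 2 - d := by
        refine hA.le_of_arc i _ hi (by omega) fun a ha => ?_
        obtain ⟨t, ht, hl, hc⟩ := key a ha
        have := hA.le a ha
        omega
      omega
    · right
      have h4 : ∀ a ∈ A, a = 0 ∨ a = k := fun a ha => by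
        obtain ⟨t, ht, hl, hc⟩ := key a ha
        have := hA.le a ha
        omega
      have h5 := hA.two_mul_le h4
      refine ⟨h4, ?_, ?_, ?_⟩
      · rw [Nat.even_iff]; omega
      all_goals omega

/-- Arithmetic form of the equivalence between indistinguishable vertices and the
configurations `A`, `B`, `C`. -/
theorem vertex_iff (hg : 3 ≤ g) (hA : IsTightArc g A k)
    (hthr : ∀ i d d', d' ≤ d → thr i d → thr i d') :
    (∃ i < g, ∃ j < g, ∃ d, i ≠ j ∧ (d = 0 ∨ thr i d) ∧
      ∀ l ∈ A, cycDist g l j = cycDist g l i + d) ↔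
    ((A.ncard = 2 ∧ Even g ∧ k = g / 2) ∨
      (k ≤ g / 2 - 1 ∧ ∃ i, ((k ≤ i ∧ i ≤ g / 2 - 1) ∨ ((g + 1) / 2 + k + 1 ≤ i ∧ i ≤ g - 1) ∨
        i = 0) ∧ thr i 1) ∨
      (A.ncard = 2 ∧ Even g ∧ k ≤ g / 2 ∧ ∃ i ≤ k, thr i (g / 2 - k))) := by
  have hk := hA.lt
  have hk0 := hA.pos
  rw [hA.ncard_eq_two_iff]
  constructor
  · rintro ⟨i, hi, j, hj, d, hij, hd, heq⟩
    rcases Nat.eq_zero_or_pos d with rfl | hd0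
    · exact Or.inl (hA.eq_half_of_cycDist_eq hi hj hij heq)
    · have hd : thr i d := hd.resolve_left (by omega)
      rcases hA.cases_of_cycDist_add hi hj hd0 heq with ⟨h1, h2⟩ | ⟨h1, h2, h3, h4, -⟩
      · exact Or.inr (Or.inl ⟨h1, i, h2, hthr _ _ _ hd0 hd⟩)
      · exact Or.inr (Or.inr ⟨h1, h2, by omega, i, h4, hthr _ _ _ (by omega) hd⟩)
  · have hAcase : (∀ a ∈ A, a = 0 ∨ a = k) → Even g → k = g / 2 →
        ∃ i < g, ∃ j < g, ∃ d, i ≠ j ∧ (d = 0 ∨ thr i d) ∧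
          ∀ l ∈ A, cycDist g l j = cycDist g l i + d := by
      intro h1 h2 h3
      rw [Nat.even_iff] at h2
      refine ⟨1, by omega, g - 1, by omega, 0, by omega, Or.inl rfl, fun l hl => ?_⟩
      have := h1 l hl
      unfold cycDist
      omega
    rintro (⟨h1, h2, h3⟩ | ⟨h1, i, h2, h3⟩ | ⟨h1, h2, h3, i, h4, h5⟩)
    · exact hAcase h1 h2 h3
    · by_cases h4 : k ≤ i
      · by_cases h5 : i ≤ g / 2 - 1
        · refine ⟨i, by omega, i + 1, by omega, 1, by omega, Or.inr h3, fun l hl => ?_⟩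
          have := hA.le l hl
          unfold cycDist
          omega
        · refine ⟨i, by omega, i - 1, by omega, 1, by omega, Or.inr h3, fun l hl => ?_⟩
          have := hA.le l hl
          unfold cycDist
          omega
      · obtain rfl : i = 0 := by omega
        refine ⟨0, by omega, g - 1, by omega, 1, by omega, Or.inr h3, fun l hl => ?_⟩
        have := hA.le l hl
        unfold cycDist
        omega
    · by_cases h6 : k = g / 2
      · exact hAcase h1 h2 h6
      · rw [Nat.even_iff] at h2
        refine ⟨i, by omega, g / 2 + k - i, by omega, _, by omega, Or.inr h5, fun l hl => ?_⟩
        have := h1 l hl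
        unfold cycDist
        omega

/-- Arithmetic form of the equivalence between indistinguishable edges and the
configurations `A`, `D`, `E`. -/
theorem edge_iff (hg : 3 ≤ g) (hA : IsTightArc g A k)
    (hthr : ∀ i d d', d' ≤ d → thr i d → thr i d') :
    ((∃ i < g, ∃ j < g, i ≠ j ∧ ∀ l ∈ A, min (cycDist g l i) (cycDist g l (i + 1)) =
        min (cycDist g l j) (cycDist g l (j + 1))) ∨
      (∃ i < g, ∃ j < g, ∃ d, 0 < d ∧ thr i d ∧ ∀ l ∈ A,
        min (cycDist g l j) (cycDist g l (j + 1)) + 1 = cycDist g l i + d) ∨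
      ∃ i < g, ∃ j < g, ∃ d, i ≠ j ∧ thr i (d + 1) ∧ thr j 1 ∧
        ∀ l ∈ A, cycDist g l j = cycDist g l i + d) ↔
    ((A.ncard = 2 ∧ Even g ∧ k = g / 2) ∨
      (k ≤ (g + 1) / 2 - 1 ∧ ∃ i, ((k ≤ i ∧ i ≤ (g + 1) / 2 - 1) ∨
        (g / 2 + k + 1 ≤ i ∧ i ≤ g - 1) ∨ i = 0) ∧ thr i 1) ∨
      (A.ncard = 2 ∧ ∃ i ≤ k, thr i (g / 2 - k + 1) ∧ (Even g → thr (g / 2 + k - i) 1))) := by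
  have hk := hA.lt
  have hk0 := hA.pos
  rw [hA.ncard_eq_two_iff]
  constructor
  · rintro (⟨i, hi, j, hj, hij, heq⟩ | ⟨i, hi, j, hj, d, hd0, hd, heq⟩ |
      ⟨i, hi, j, hj, d, hij, hd, hj1, heq⟩)
    · left
      have h0 : i + j + 1 = g := by
        have := heq 0 hA.zero_mem
        rw [min_cycDist_of_le (Nat.zero_le _) hi, min_cycDist_of_le (Nat.zero_le _) hj] at this
        omega
      have h1 : ∀ a ∈ A, a = 0 ∨ 2 * a = g := fun a ha => by
        have h2 := heq a ha
        have h3 := hA.le a ha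
        rcases Nat.lt_or_ge i a with h4 | h4 <;> rcases Nat.lt_or_ge j a with h5 | h5
        · rw [min_cycDist_of_lt h4 (by omega), min_cycDist_of_lt h5 (by omega)] at h2; omega
        · rw [min_cycDist_of_lt h4 (by omega), min_cycDist_of_le h5 hj] at h2; omega
        · rw [min_cycDist_of_le h4 hi, min_cycDist_of_lt h5 (by omega)] at h2; omega
        · rw [min_cycDist_of_le h4 hi, min_cycDist_of_le h5 hj] at h2; omega
      have h2 := h1 k hA.mem
      refine ⟨fun a ha => ?_, ⟨g / 2, by omega⟩, by omega⟩
      have := h1 a ha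
      omega
    · right
      rcases hA.cases_of_edge hi hj hd0 heq with ⟨h1, h2⟩ | ⟨h1, h2, h3, h4⟩
      · exact Or.inl ⟨h1, i, h2, hthr _ _ _ hd0 hd⟩
      · have := hA.two_mul_le h1
        exact Or.inr ⟨h1, i, h4, hthr _ _ _ (by omega) hd, fun h => absurd h h2⟩
    · rcases Nat.eq_zero_or_pos d with rfl | hd0
      · exact Or.inl (hA.eq_half_of_cycDist_eq hi hj hij heq)
      · right
        rcases hA.cases_of_cycDist_add hi hj hd0 heq with ⟨h1, h2⟩ | ⟨h1, h2, h3, h4, h5⟩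
        · exact Or.inl ⟨by omega, i, by omega, hthr _ _ _ (by omega) hd⟩
        · exact Or.inr ⟨h1, i, h4, hthr _ _ _ (by omega) hd, fun _ => h5 ▸ hj1⟩
  · have hAcase : (∀ a ∈ A, a = 0 ∨ a = k) → Even g → k = g / 2 →
        ∃ i < g, ∃ j < g, i ≠ j ∧ ∀ l ∈ A, min (cycDist g l i) (cycDist g l (i + 1)) =
          min (cycDist g l j) (cycDist g l (j + 1)) := by
      intro h1 h2 h3
      rw [Nat.even_iff] at h2
      refine ⟨0, by omega, g - 1, by omega, by omega, fun l hl => ?_⟩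
      rw [min_cycDist_of_le (b := g - 1) (by have := hA.le l hl; omega) (by omega)]
      rcases h1 l hl with rfl | rfl
      · rw [min_cycDist_of_le le_rfl (by omega)]; omega
      · rw [min_cycDist_of_lt hk0 hk]; omega
    rintro (⟨h1, h2, h3⟩ | ⟨h1, i, h2, h3⟩ | ⟨h1, i, h4, h5, h6⟩)
    · exact Or.inl (hAcase h1 h2 h3)
    · right; left
      by_cases h4 : k ≤ i
      · by_cases h5 : i ≤ (g + 1) / 2 - 1
        · refine ⟨i, by omega, i, by omega, 1, by omega, h3, fun l hl => ?_⟩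
          have := hA.le l hl
          rw [min_cycDist_of_le (by omega) (by omega)]
          unfold cycDist
          omega
        · refine ⟨i, by omega, i - 1, by omega, 1, by omega, h3, fun l hl => ?_⟩
          have := hA.le l hl
          rw [min_cycDist_of_le (by omega) (by omega)]
          unfold cycDist
          omega
      · obtain rfl : i = 0 := by omega
        refine ⟨0, by omega, g - 1, by omega, 1, by omega, h3, fun l hl => ?_⟩
        have := hA.le l hl
        rw [min_cycDist_of_le (by omega) (by omega), cycDist_zero]
        omega
    · have h7 := hA.two_mul_le h1
      by_cases h2 : Even g
      · by_cases h8 : k = g / 2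
        · exact Or.inl (hAcase h1 h2 h8)
        · right; right
          have h6 := h6 h2
          rw [Nat.even_iff] at h2
          refine ⟨i, by omega, g / 2 + k - i, by omega, _, by omega, h5, h6, fun l hl => ?_⟩
          have := h1 l hl
          unfold cycDist
          omega
      · right; left
        rw [Nat.even_iff] at h2
        refine ⟨i, by omega, g / 2 + k - i, by omega, _, by omega, h5, fun l hl => ?_⟩
        have := h1 l hl
        rw [min_cycDist_of_le (by omega) (by omega)]
        unfold cycDist
        omega

end IsTightArc

namespace CycTree

variable {V : Type*} {G : SimpleGraph V} {g : ℕ} {vc : ZMod g → V} {π : V → ZMod g} {h : V → ℕ}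
  {p : V → V}

theorem isCycleLabelling (H : CycTree G g vc π h p) : IsCycleLabelling G g vc := ⟨H.inj, H.adj⟩

theorem cycleEdges_eq (H : CycTree G g vc π h p) :
    cycleEdges g vc = {e | e ∈ G.edgeSet ∧ ∀ x ∈ e, x ∈ Set.range vc} := by
  ext e
  constructor
  · rintro ⟨i, rfl⟩
    refine ⟨H.adj i, fun x hx => ?_⟩
    rcases Sym2.mem_iff.1 hx with rfl | rfl <;> exact Set.mem_range_self _
  · rintro ⟨he, hr⟩
    induction e with
    | _ x y =>
      obtain ⟨i, rfl⟩ := hr x (Sym2.mem_mk_left _ _)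
      obtain ⟨j, rfl⟩ := hr y (Sym2.mem_mk_right _ _)
      have hi := H.height_root i
      have hj := H.height_root j
      rcases H.cover _ _ he with hc | ⟨hc, -⟩ | ⟨hc, -⟩
      · exact hc
      · exact absurd hi hc.ne'
      · exact absurd hj hc.ne'

theorem reachable_root (H : CycTree G g vc π h p) (x : V) : inTree G g vc (π x) x := by
  induction hn : h x generalizing x with
  | zero => rw [inTree, H.eq_root x hn]
  | succ n ih =>
    have hx : 0 < h x := by omega
    have hp := ih (p x) (by have := H.height_parent x hx; omega)
    rw [H.proj_parent x hx] at hp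
    refine hp.trans (Adj.reachable ?_)
    refine (deleteEdges_adj.2 ⟨H.adj_parent x hx, ?_⟩).symm
    rw [H.cycleEdges_eq]
    rintro ⟨-, hr⟩
    obtain ⟨i, rfl⟩ := hr x (Sym2.mem_mk_left _ _)
    rw [H.height_root] at hx
    exact absurd hx (lt_irrefl 0)

theorem inTree_iff (H : CycTree G g vc π h p) {i : ZMod g} {x : V} :
    inTree G g vc i x ↔ π x = i := by
  constructor
  · rintro ⟨w⟩
    have key : ∀ {a b : V} (w : (offCycle G g vc).Walk a b), π b = π a := by
      intro a b w
      induction w with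
      | nil => rfl
      | cons hab _ ih =>
        rw [ih]
        obtain ⟨hadj, hnot⟩ := deleteEdges_adj.1 hab
        rcases H.cover _ _ hadj with hc | ⟨hc, rfl⟩ | ⟨hc, rfl⟩
        · exact absurd hc hnot
        · exact H.proj_parent _ hc
        · exact (H.proj_parent _ hc).symm
    rw [key w, H.root]
  · rintro rfl
    exact H.reachable_root x

theorem proj_congr (H : CycTree G g vc π h p) {vc' : ZMod g → V} {π' : V → ZMod g} {h' : V → ℕ}
    {p' : V → V} (H' : CycTree G g vc' π' h' p') (hr : Set.range vc' = Set.range vc) (x : V) :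
    vc' (π' x) = vc (π x) := by
  obtain ⟨j, hj⟩ : vc' (π' x) ∈ Set.range vc := hr ▸ Set.mem_range_self _
  have hx := H'.reachable_root x
  have he : offCycle G g vc' = offCycle G g vc := by
    rw [offCycle, offCycle, H.cycleEdges_eq, H'.cycleEdges_eq, hr]
  rw [inTree, he, ← hj] at hx
  rw [← hj, H.inTree_iff.1 hx]

theorem proj_eq_iff (H : CycTree G g vc π h p) {vc' : ZMod g → V} {π' : V → ZMod g} {h' : V → ℕ}
    {p' : V → V} (H' : CycTree G g vc' π' h' p') (hr : Set.range vc' = Set.range vc) (x y : V) :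
    π' x = π' y ↔ π x = π y := by
  rw [← H'.inj.eq_iff, ← H.inj.eq_iff, H.proj_congr H' hr, H.proj_congr H' hr]

theorem rotate (H : CycTree G g vc π h p) (c : ZMod g) :
    CycTree G g (fun x => vc (c + x)) (fun x => π x - c) h p where
  conn := H.conn
  inj a b hab := by simpa using H.inj hab
  adj i := by simpa [add_assoc] using H.adj (c + i)
  three_le := H.three_le
  root i := by simp [H.root]
  height_root i := H.height_root _
  eq_root x hx := by simpa using H.eq_root x hx
  adj_parent := H.adj_parent
  height_parent := H.height_parent
  proj_parent x hx := by simp [H.proj_parent x hx]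
  cover x y hxy := by
    rcases H.cover x y hxy with ⟨i, hi⟩ | hc
    · exact Or.inl ⟨i - c, by rw [hi, ← add_assoc]; simp⟩
    · exact Or.inr hc

theorem range_rotate (vc : ZMod g → V) (c : ZMod g) :
    Set.range (fun x => vc (c + x)) = Set.range vc :=
  (Equiv.addLeft c).surjective.range_comp vc

theorem sActive_iff (H : CycTree G g vc π h p) {S : Set V} {i : ZMod g} :
    SActive G g vc S i ↔ ∃ s ∈ S, π s = i := by simp [SActive, H.inTree_iff]

theorem aS_eq (H : CycTree G g vc π h p) (S : Set V) :
    aS G g vc S = ((fun s => (π s).val) '' S).ncard := by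
  have := H.neZero
  have he : {i : ZMod g | SActive G g vc S i} = π '' S := by
    ext i; simp [H.sActive_iff]
  rw [aS, he, ← Set.ncard_image_of_injective _ (ZMod.val_injective g), Set.image_image]

theorem kOf_eq (H : CycTree G g vc π h p) (S : Set V) :
    kOf G g vc S = sSup ((fun s => (π s).val) '' S) := by
  have := H.neZero
  rw [kOf]
  congr 1
  ext n
  simp only [Set.mem_ofPred_eq, H.sActive_iff, Set.mem_image]
  constructor
  · rintro ⟨hn, s, hs, hsn⟩
    exact ⟨s, hs, by rw [hsn, ZMod.val_natCast_of_lt hn]⟩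
  · rintro ⟨s, hs, rfl⟩
    exact ⟨ZMod.val_lt _, s, hs, by simp⟩

theorem kOf_le (H : CycTree G g vc π h p) {S : Set V} (hS : S.Nonempty) {m : ℕ}
    (hm : ∀ s ∈ S, (π s).val ≤ m) : kOf G g vc S ≤ m := by
  rw [H.kOf_eq]
  refine csSup_le (hS.image _) ?_
  rintro _ ⟨s, hs, rfl⟩
  exact hm s hs

theorem biactive_iff (H : CycTree G g vc π h p) {S : Set V} :
    Biactive G g vc S ↔ ∃ s ∈ S, ∃ s' ∈ S, π s ≠ π s' := by
  have := H.neZero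
  have he : {i : ZMod g | SActive G g vc S i} = π '' S := by
    ext i; simp [H.sActive_iff]
  rw [Biactive, aS, he, Nat.succ_le_iff, Set.one_lt_ncard_iff (Set.toFinite _)]
  constructor
  · rintro ⟨_, _, ⟨s, hs, rfl⟩, ⟨s', hs', rfl⟩, hne⟩
    exact ⟨s, hs, s', hs', hne⟩
  · rintro ⟨s, hs, s', hs', hne⟩
    exact ⟨_, _, ⟨s, hs, rfl⟩, ⟨s', hs', rfl⟩, hne⟩

theorem biactive_congr (H : CycTree G g vc π h p) {vc' : ZMod g → V} {π' : V → ZMod g}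
    {h' : V → ℕ} {p' : V → V} (H' : CycTree G g vc' π' h' p')
    (hr : Set.range vc' = Set.range vc) {S : Set V} :
    Biactive G g vc' S ↔ Biactive G g vc S := by
  simp only [H.biactive_iff, H'.biactive_iff, ne_eq, H.proj_eq_iff H' hr]

theorem cycDist_congr (H : CycTree G g vc π h p) {vc' : ZMod g → V} {π' : V → ZMod g}
    {h' : V → ℕ} {p' : V → V} (H' : CycTree G g vc' π' h' p')
    (hr : Set.range vc' = Set.range vc) (x y : V) :
    cycDist g (π' x).val (π' y).val = cycDist g (π x).val (π y).val := by
  have h₁ := H.dist_root (vc (π x)) (π y)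
  have h₂ := H'.dist_root (vc' (π' x)) (π' y)
  rw [H.height_root, H.root] at h₁
  rw [H'.height_root, H'.root, H.proj_congr H' hr, H.proj_congr H' hr] at h₂
  omega

theorem isTightArc (H : CycTree G g vc π h p) {S : Set V} (hcan : Canonical G g vc S)
    (hb : Biactive G g vc S) :
    IsTightArc g ((fun s => (π s).val) '' S) (kOf G g vc S) := by
  have := H.neZero
  obtain ⟨s₁, hs₁, s₂, hs₂, hne⟩ := H.biactive_iff.1 hb
  obtain ⟨s₀, hs₀, hπ₀⟩ := H.sActive_iff.1 hcan.2.1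
  have hbdd : BddAbove ((fun s => (π s).val) '' S) := by
    refine ⟨g, ?_⟩
    rintro _ ⟨s, -, rfl⟩
    exact (ZMod.val_lt _).le
  have hle : ∀ a ∈ (fun s => (π s).val) '' S, a ≤ kOf G g vc S := fun a ha => by
    rw [H.kOf_eq]; exact le_csSup hbdd ha
  have hmem : kOf G g vc S ∈ (fun s => (π s).val) '' S := by
    rw [H.kOf_eq]; exact Nat.sSup_mem ⟨_, s₀, hs₀, rfl⟩ hbdd
  refine ⟨⟨s₀, hs₀, by simp [hπ₀]⟩, hmem, hle, ?_, ?_, ?_⟩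
  · obtain ⟨s, -, hs⟩ := hmem
    rw [← hs]
    exact ZMod.val_lt _
  · rw [Nat.pos_iff_ne_zero]
    intro hk
    have h₁ := hle _ ⟨s₁, hs₁, rfl⟩
    have h₂ := hle _ ⟨s₂, hs₂, rfl⟩
    exact hne (ZMod.val_injective g (by simp only at h₁ h₂; omega))
  · intro c m hc hm harc
    have hoff : ∀ s ∈ S, (π s - (c : ZMod g)).val ≤ m := by
      intro s hs
      have hlt := ZMod.val_lt (π s)
      rcases harc _ ⟨s, hs, rfl⟩ with ⟨h₁, h₂⟩ | ⟨h₁, h₂⟩ <;> simp only at h₁ h₂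
      · rwa [ZMod.val_sub (by rwa [ZMod.val_natCast_of_lt hc]), ZMod.val_natCast_of_lt hc]
      · have : π s - (c : ZMod g) = (((π s).val + g - c : ℕ) : ZMod g) := by
          rw [Nat.cast_sub (by omega)]; simp
        rwa [this, ZMod.val_natCast_of_lt (by omega)]
    obtain ⟨s, hs, hmin⟩ := exists_minimalFor_of_wellFoundedLT (· ∈ S)
      (fun s => (π s - (c : ZMod g)).val) ⟨s₀, hs₀⟩
    have hmin' : ∀ s' ∈ S, (π s - (c : ZMod g)).val ≤ (π s' - (c : ZMod g)).val := fun s' hs' =>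
      (le_total _ _).elim id (fun hle => hmin hs' hle)
    have H' := H.rotate (π s)
    refine (hcan.2.2 _ H'.isCycleLabelling (range_rotate vc (π s))
      (H'.sActive_iff.2 ⟨s, hs, sub_self _⟩)).trans (H'.kOf_le ⟨s, hs⟩ fun s' hs' => ?_)
    rw [show π s' - π s = (π s' - (c : ZMod g)) - (π s - (c : ZMod g)) by ring,
      ZMod.val_sub (hmin' s' hs')]
    exact (Nat.sub_le _ _).trans (hoff s' hs')

theorem exists_canonical (H : CycTree G g vc π h p) {S : Set V} (hS : S.Nonempty) :
    ∃ vc' : ZMod g → V, Set.range vc' = Set.range vc ∧ Canonical G g vc' S := by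
  obtain ⟨s, hs⟩ := hS
  have H' := H.rotate (π s)
  have hex : {vc' : ZMod g → V | IsCycleLabelling G g vc' ∧ Set.range vc' = Set.range vc ∧
      SActive G g vc' S 0}.Nonempty :=
    ⟨_, H'.isCycleLabelling, range_rotate vc (π s), H'.sActive_iff.2 ⟨s, hs, sub_self _⟩⟩
  obtain ⟨vc', ⟨hlab, hr, hact⟩, hmin⟩ :=
    exists_minimalFor_of_wellFoundedLT _ (fun vc' => kOf G g vc' S) hex
  exact ⟨vc', hr, hlab, hact, fun vc'' hlab' hr' hact' =>
    (le_total _ _).elim id fun hle => hmin ⟨hlab', hr'.trans hr, hact'⟩ hle⟩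

end CycTree

theorem cycDist_val_add_one {g l : ℕ} [NeZero g] (hg : 3 ≤ g) (hl : l < g) (i : ZMod g) :
    cycDist g l (i + 1).val = cycDist g l (i.val + 1) := by
  have := ZMod.val_lt i
  rcases ZMod.val_succ_cases hg i with h | h <;> simp only [cycDist] <;> omega

theorem hasFreeThread_one {V : Type*} [Fintype V] {G : SimpleGraph V} [DecidableRel G.Adj]
    {g : ℕ} {vc : ZMod g → V} {S : Set V} {i : ZMod g} :
    HasFreeThread G vc S i 1 ↔ ∃ t, IsThreadAt G (vc i) t ∧ SFree S t :=
  exists_congr fun _ => and_congr_right fun ht =>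
    and_iff_left (List.length_pos_iff.2 ht.1)

theorem ZMod.exists_iff_lt {g : ℕ} [NeZero g] {P : ZMod g → Prop} :
    (∃ i, P i) ↔ ∃ i < g, P (i : ℕ) := by
  constructor
  · rintro ⟨i, hi⟩
    exact ⟨i.val, ZMod.val_lt i, by simpa using hi⟩
  · rintro ⟨i, -, hi⟩
    exact ⟨_, hi⟩

theorem ZMod.natCast_ne_natCast_iff {g i j : ℕ} (hi : i < g) (hj : j < g) :
    (i : ZMod g) ≠ j ↔ i ≠ j := by
  rw [ne_eq, ZMod.natCast_eq_natCast_iff', Nat.mod_eq_of_lt hi, Nat.mod_eq_of_lt hj]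

namespace CycTree

variable {V : Type*} [Fintype V] {G : SimpleGraph V} [DecidableRel G.Adj] {g : ℕ}
  {vc : ZMod g → V} {π : V → ZMod g} {h : V → ℕ} {p : V → V} {S : Set V}

theorem isVertexMG_iff_config (H : CycTree G g vc π h p) (hS : BranchResolving G S)
    (hb : Biactive G g vc S) (hcan : Canonical G g vc S) :
    IsVertexMG G S ↔ ¬ (ConfigA G g vc S ∨ ConfigB G g vc S ∨ ConfigC G g vc S) := by
  have := H.neZero
  have hA := H.isTightArc hcan hb
  have key := hA.vertex_iff (thr := fun i d => HasFreeThread G vc S (i : ZMod g) d) H.three_le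
    fun _ _ _ hd ht => ht.mono hd
  rw [← H.aS_eq] at key
  simp only [hasFreeThread_one] at key
  rw [H.isVertexMG_iff hS (H.biactive_iff.1 hb)]
  refine not_congr (Iff.trans ?_ key)
  rw [ZMod.exists_iff_lt]
  refine exists_congr fun i => and_congr_right fun hi => ?_
  rw [ZMod.exists_iff_lt]
  refine exists_congr fun j => and_congr_right fun hj => ?_
  simp only [ZMod.natCast_ne_natCast_iff hi hj, ZMod.val_natCast_of_lt hi,
    ZMod.val_natCast_of_lt hj, Set.forall_mem_image]

theorem isEdgeMG_iff_config (H : CycTree G g vc π h p) (hS : BranchResolving G S)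
    (hb : Biactive G g vc S) (hcan : Canonical G g vc S) :
    IsEdgeMG G S ↔ ¬ (ConfigA G g vc S ∨ ConfigD G g vc S ∨ ConfigE G g vc S) := by
  have := H.neZero
  have hA := H.isTightArc hcan hb
  have key := hA.edge_iff (thr := fun i d => HasFreeThread G vc S (i : ZMod g) d) H.three_le
    fun _ _ _ hd ht => ht.mono hd
  rw [← H.aS_eq] at key
  simp only [hasFreeThread_one] at key
  rw [H.isEdgeMG_iff hS (H.biactive_iff.1 hb)]
  refine not_congr (Iff.trans ?_ key)
  have hsucc : ∀ (s : V) (i : ZMod g), cycDist g (π s).val (i + 1).val =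
      cycDist g (π s).val (i.val + 1) := fun s i =>
    cycDist_val_add_one H.three_le (ZMod.val_lt _) i
  simp only [hsucc]
  refine or_congr ?_ (or_congr ?_ ?_) <;>
  · rw [ZMod.exists_iff_lt]
    refine exists_congr fun i => and_congr_right fun hi => ?_
    rw [ZMod.exists_iff_lt]
    refine exists_congr fun j => and_congr_right fun hj => ?_
    simp only [ZMod.natCast_ne_natCast_iff hi hj, ZMod.val_natCast_of_lt hi,
      ZMod.val_natCast_of_lt hj, Set.forall_mem_image, hasFreeThread_one]

end CycTree

theorem exists_cycDist_sum_eq {g a b : ℕ} (hg : 3 ≤ g) (ha : a < g) (hb : b < g) (hab : a ≠ b) :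
    ∃ c < g, c ≠ a ∧ c ≠ b ∧ cycDist g a b + cycDist g b c + cycDist g a c = g := by
  wlog hlt : a < b generalizing a b
  · obtain ⟨c, hc, hca, hcb, hsum⟩ := this hb ha hab.symm (by omega)
    exact ⟨c, hc, hcb, hca, by rw [cycDist_comm g a b]; omega⟩
  by_cases h₁ : 2 * (b - a) ≤ g
  · obtain ⟨t, ht₁, ht₂⟩ : ∃ t, 2 * t ≤ g - (b - a) ∧ g - (b - a) < 2 * t + 2 :=
      ⟨(g - (b - a)) / 2, by omega, by omega⟩
    have e₁ : cycDist g a b = b - a := by simp only [cycDist]; omega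
    by_cases h₂ : b + t < g
    · have e₂ : cycDist g b (b + t) = t := by simp only [cycDist]; omega
      have e₃ : cycDist g a (b + t) = g - (b - a) - t := by simp only [cycDist]; omega
      exact ⟨b + t, h₂, by omega, by omega, by omega⟩
    · have e₂ : cycDist g b (b + t - g) = t := by simp only [cycDist]; omega
      have e₃ : cycDist g a (b + t - g) = g - (b - a) - t := by simp only [cycDist]; omega
      exact ⟨b + t - g, by omega, by omega, by omega, by omega⟩
  · obtain ⟨t, ht₁, ht₂⟩ : ∃ t, 2 * t ≤ b - a ∧ b - a < 2 * t + 2 :=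
      ⟨(b - a) / 2, by omega, by omega⟩
    have e₁ : cycDist g a b = g - (b - a) := by simp only [cycDist]; omega
    have e₂ : cycDist g b (a + t) = b - a - t := by simp only [cycDist]; omega
    have e₃ : cycDist g a (a + t) = t := by simp only [cycDist]; omega
    exact ⟨a + t, by omega, by omega, by omega, by omega⟩

theorem half_lt_of_cycDist_sum_eq {g a b c k : ℕ} (ha : a ≤ k) (hb : b ≤ k) (hc : c ≤ k)
    (hsum : cycDist g a b + cycDist g b c + cycDist g a c = g) : g ≤ 2 * k := by
  simp only [cycDist] at hsum
  omega

theorem isVertexMG_univ {V : Type*} {G : SimpleGraph V} (hc : G.Connected) :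
    IsVertexMG G Set.univ := fun u v huv =>
  ⟨u, trivial, by rw [dist_self]; exact (hc.pos_dist_of_ne huv).ne⟩

section Dimension

variable {V : Type*} [Fintype V] {G : SimpleGraph V} [DecidableRel G.Adj]

theorem BranchResolving.mono {S T : Set V} (hS : BranchResolving G S) (hST : S ⊆ T) :
    BranchResolving G T := fun v t₁ t₂ h₁ h₂ hne =>
  (hS v t₁ t₂ h₁ h₂ hne).imp (fun ⟨s, hs, ht⟩ => ⟨s, hST hs, ht⟩)
    fun ⟨s, hs, ht⟩ => ⟨s, hST hs, ht⟩

theorem SmallestBBR.sInf_card {g : ℕ} {vc : ZMod g → V} {S : Finset V}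
    (hS : SmallestBBR G g vc S) {P C : Set V → Prop}
    (hP : ∀ T : Set V, P T → BranchResolving G T ∧ Biactive G g vc T)
    (hC : ∀ T : Set V, BranchResolving G T → Biactive G g vc T → (P T ↔ ¬ C T))
    (hex : ∃ T : Finset V, T.card ≤ S.card + 1 ∧ P T) :
    ((∃ T : Finset V, SmallestBBR G g vc T ∧ ¬ C T) →
      sInf {n | ∃ T : Finset V, T.card = n ∧ P T} = S.card) ∧
    (¬ (∃ T : Finset V, SmallestBBR G g vc T ∧ ¬ C T) →
      sInf {n | ∃ T : Finset V, T.card = n ∧ P T} = S.card + 1) := by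
  obtain ⟨T₁, hcard₁, hT₁⟩ := hex
  obtain ⟨T₀, hcard₀, hT₀⟩ := Nat.sInf_mem (s := {n | ∃ T : Finset V, T.card = n ∧ P T})
    ⟨_, T₁, rfl, hT₁⟩
  have hle : ∀ T : Finset V, P T → sInf {n | ∃ T : Finset V, T.card = n ∧ P T} ≤ T.card :=
    fun T hT => Nat.sInf_le ⟨T, rfl, hT⟩
  have hlow := hS.2.2 T₀ (hP _ hT₀).1 (hP _ hT₀).2
  constructor
  · rintro ⟨T, hT, hnot⟩
    have h₁ := hle T ((hC _ hT.1 hT.2.1).2 hnot)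
    have h₂ := hT.2.2 S hS.1 hS.2.1
    omega
  · intro hneg
    have h₁ := hle T₁ hT₁
    by_contra hne
    have hT : SmallestBBR G g vc T₀ := ⟨(hP _ hT₀).1, (hP _ hT₀).2, fun S' h₁ h₂ => by
      have := hS.2.2 S' h₁ h₂
      omega⟩
    exact hneg ⟨T₀, hT, (hC _ hT.1 hT.2.1).1 hT₀⟩

namespace CycTree

variable {g : ℕ} {vc : ZMod g → V} {π : V → ZMod g} {h : V → ℕ} {p : V → V} {S : Set V}

theorem isMG_of_cycDist_sum_eq [DecidableEq V] (hG : IsUnicyclic G) (H : CycTree G g vc π h p)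
    (hS : BranchResolving G S) {s₁ s₂ s₃ : V} (hs₁ : s₁ ∈ S) (hs₂ : s₂ ∈ S) (hs₃ : s₃ ∈ S)
    (h₁₂ : π s₁ ≠ π s₂) (h₁₃ : π s₁ ≠ π s₃) (h₂₃ : π s₂ ≠ π s₃)
    (hsum : cycDist g (π s₁).val (π s₂).val + cycDist g (π s₂).val (π s₃).val +
      cycDist g (π s₁).val (π s₃).val = g) : IsVertexMG G S ∧ IsEdgeMG G S := by
  have := H.neZero
  have hg := H.three_le
  obtain ⟨vc', hr, hcan⟩ := H.exists_canonical ⟨s₁, hs₁⟩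
  obtain ⟨π', h', p', H'⟩ := exists_cycTree hG H.three_le hcan.1
  have hb : Biactive G g vc' S :=
    (H.biactive_congr H' hr).2 (H.biactive_iff.2 ⟨s₁, hs₁, s₂, hs₂, h₁₂⟩)
  rw [← H.cycDist_congr H' hr, ← H.cycDist_congr H' hr, ← H.cycDist_congr H' hr] at hsum
  rw [ne_eq, ← H.proj_eq_iff H' hr, ← (ZMod.val_injective g).eq_iff] at h₁₂ h₁₃ h₂₃
  have hA := H'.isTightArc hcan hb
  have hm₁ := Set.mem_image_of_mem (fun s => (π' s).val) hs₁
  have hm₂ := Set.mem_image_of_mem (fun s => (π' s).val) hs₂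
  have hm₃ := Set.mem_image_of_mem (fun s => (π' s).val) hs₃
  have hk := half_lt_of_cycDist_sum_eq (hA.le _ hm₁) (hA.le _ hm₂) (hA.le _ hm₃) hsum
  have haS : aS G g vc' S ≠ 2 := by
    rw [H'.aS_eq, ne_eq, hA.ncard_eq_two_iff]
    intro hall
    have e₁ := hall _ hm₁
    have e₂ := hall _ hm₂
    have e₃ := hall _ hm₃
    omega
  rw [H'.isVertexMG_iff_config hS hb hcan, H'.isEdgeMG_iff_config hS hb hcan]
  constructor
  · rintro (hc | hc | hc)
    · exact haS hc.1
    · have := hc.1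
      omega
    · exact haS hc.1
  · rintro (hc | hc | hc)
    · exact haS hc.1
    · have := hc.1
      omega
    · exact haS hc.1

end CycTree

variable [DecidableEq V] {g : ℕ} {vc : ZMod g → V}

theorem isVertexMG_iff_not_containsABC (hG : IsUnicyclic G) (hg : 3 ≤ g)
    (hvc : IsCycleLabelling G g vc) {S : Set V} (hS : BranchResolving G S)
    (hb : Biactive G g vc S) : IsVertexMG G S ↔ ¬ ContainsABC G g vc S := by
  obtain ⟨π, h, p, H⟩ := exists_cycTree hG hg hvc
  have key : ∀ vc', Set.range vc' = Set.range vc → Canonical G g vc' S →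
      (IsVertexMG G S ↔ ¬ (ConfigA G g vc' S ∨ ConfigB G g vc' S ∨ ConfigC G g vc' S)) := by
    intro vc' hr hcan
    obtain ⟨π', h', p', H'⟩ := exists_cycTree hG hg hcan.1
    exact H'.isVertexMG_iff_config hS ((H.biactive_congr H' hr).2 hb) hcan
  constructor
  · rintro hMG (⟨vc', -, hr, hcan, hc⟩ | ⟨vc', -, hr, hcan, hc⟩ | ⟨vc', -, hr, hcan, hc⟩)
    · exact (key vc' hr hcan).1 hMG (Or.inl hc)
    · exact (key vc' hr hcan).1 hMG (Or.inr (Or.inl hc))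
    · exact (key vc' hr hcan).1 hMG (Or.inr (Or.inr hc))
  · intro hnot
    obtain ⟨s, hs, -⟩ := H.biactive_iff.1 hb
    obtain ⟨vc', hr, hcan⟩ := H.exists_canonical ⟨s, hs⟩
    refine (key vc' hr hcan).2 fun hc => hnot (hc.imp ?_ (Or.imp ?_ ?_)) <;>
    exact fun hc => ⟨vc', hcan.1, hr, hcan, hc⟩

theorem isEdgeMG_iff_not_containsADE (hG : IsUnicyclic G) (hg : 3 ≤ g)
    (hvc : IsCycleLabelling G g vc) {S : Set V} (hS : BranchResolving G S)
    (hb : Biactive G g vc S) : IsEdgeMG G S ↔ ¬ ContainsADE G g vc S := by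
  obtain ⟨π, h, p, H⟩ := exists_cycTree hG hg hvc
  have key : ∀ vc', Set.range vc' = Set.range vc → Canonical G g vc' S →
      (IsEdgeMG G S ↔ ¬ (ConfigA G g vc' S ∨ ConfigD G g vc' S ∨ ConfigE G g vc' S)) := by
    intro vc' hr hcan
    obtain ⟨π', h', p', H'⟩ := exists_cycTree hG hg hcan.1
    exact H'.isEdgeMG_iff_config hS ((H.biactive_congr H' hr).2 hb) hcan
  constructor
  · rintro hMG (⟨vc', -, hr, hcan, hc⟩ | ⟨vc', -, hr, hcan, hc⟩ | ⟨vc', -, hr, hcan, hc⟩)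
    · exact (key vc' hr hcan).1 hMG (Or.inl hc)
    · exact (key vc' hr hcan).1 hMG (Or.inr (Or.inl hc))
    · exact (key vc' hr hcan).1 hMG (Or.inr (Or.inr hc))
  · intro hnot
    obtain ⟨s, hs, -⟩ := H.biactive_iff.1 hb
    obtain ⟨vc', hr, hcan⟩ := H.exists_canonical ⟨s, hs⟩
    refine (key vc' hr hcan).2 fun hc => hnot (hc.imp ?_ (Or.imp ?_ ?_)) <;>
    exact fun hc => ⟨vc', hcan.1, hr, hcan, hc⟩

theorem exists_smallestBBR (hG : IsUnicyclic G) (hg : 3 ≤ g) (hvc : IsCycleLabelling G g vc) :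
    ∃ S : Finset V, SmallestBBR G g vc S := by
  obtain ⟨π, h, p, H⟩ := exists_cycTree hG hg hvc
  have huniv : IsVertexMG G ((Finset.univ : Finset V) : Set V) := by
    simpa using isVertexMG_univ hG.1
  obtain ⟨S, ⟨hS, hb⟩, hmin⟩ := exists_minimalFor_of_wellFoundedLT
    (fun S : Finset V => BranchResolving G (S : Set V) ∧ Biactive G g vc (S : Set V)) Finset.card
    ⟨_, huniv.branchResolving hG.1, H.biactive_iff.2 (huniv.exists_proj_ne H)⟩
  exact ⟨S, hS, hb, fun S' hS' hb' => (le_total _ _).elim id (hmin ⟨hS', hb'⟩)⟩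

theorem SmallestBBR.exists_isMG (hG : IsUnicyclic G) (hg : 3 ≤ g)
    (hvc : IsCycleLabelling G g vc) {S : Finset V} (hS : SmallestBBR G g vc S) :
    ∃ T : Finset V, T.card ≤ S.card + 1 ∧ IsVertexMG G (T : Set V) ∧ IsEdgeMG G (T : Set V) := by
  obtain ⟨π, h, p, H⟩ := exists_cycTree hG hg hvc
  have := H.neZero
  obtain ⟨s₁, hs₁, s₂, hs₂, hne⟩ := H.biactive_iff.1 hS.2.1
  obtain ⟨c, hc, hc₁, hc₂, hsum⟩ := exists_cycDist_sum_eq hg (ZMod.val_lt (π s₁))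
    (ZMod.val_lt (π s₂)) ((ZMod.val_injective g).ne hne)
  have hπ : (π (vc (c : ZMod g))).val = c := by rw [H.root, ZMod.val_natCast_of_lt hc]
  refine ⟨insert (vc (c : ZMod g)) S, Finset.card_insert_le _ _,
    H.isMG_of_cycDist_sum_eq hG (hS.1.mono (by simp)) (s₁ := s₁) (s₂ := s₂)
      (s₃ := vc (c : ZMod g)) (by simpa using Or.inr hs₁) (by simpa using Or.inr hs₂) (by simp)
      hne ?_ ?_ (by rwa [hπ])⟩
  · rintro he
    exact hc₁ (by rw [he, hπ])
  · rintro he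
    exact hc₂ (by rw [he, hπ])

end Dimension

theorem statement_12 {V : Type*} [Fintype V] [DecidableEq V] (G : SimpleGraph V)
    [DecidableRel G.Adj] (hG : IsUnicyclic G) (g : ℕ) (hg : 3 ≤ g)
    (vc : ZMod g → V) (hvc : IsCycleLabelling G g vc) :
    (¬ ABCneg G g vc ∧ ADEneg G g vc → (metricDim G : ℤ) - edgeMetricDim G = 1) ∧
    (ABCneg G g vc ∧ ¬ ADEneg G g vc → (metricDim G : ℤ) - edgeMetricDim G = -1) ∧
    (¬ (¬ ABCneg G g vc ∧ ADEneg G g vc) → ¬ (ABCneg G g vc ∧ ¬ ADEneg G g vc) →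
      (metricDim G : ℤ) - edgeMetricDim G = 0) := by
  obtain ⟨π, h, p, H⟩ := exists_cycTree hG hg hvc
  obtain ⟨S, hS⟩ := exists_smallestBBR hG hg hvc
  obtain ⟨T, hcard, hTv, hTe⟩ := hS.exists_isMG hG hg hvc
  have hv : (ABCneg G g vc → metricDim G = S.card) ∧
      (¬ ABCneg G g vc → metricDim G = S.card + 1) :=
    hS.sInf_card (C := ContainsABC G g vc)
      (fun T hT => ⟨hT.branchResolving hG.1, H.biactive_iff.2 (hT.exists_proj_ne H)⟩)
      (fun T => isVertexMG_iff_not_containsABC hG hg hvc) ⟨T, hcard, hTv⟩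
  have he : (ADEneg G g vc → edgeMetricDim G = S.card) ∧
      (¬ ADEneg G g vc → edgeMetricDim G = S.card + 1) :=
    hS.sInf_card (C := ContainsADE G g vc)
      (fun T hT => ⟨hT.branchResolving hG.1, H.biactive_iff.2 (hT.exists_proj_ne H)⟩)
      (fun T => isEdgeMG_iff_not_containsADE hG hg hvc) ⟨T, hcard, hTe⟩
  by_cases h₁ : ABCneg G g vc <;> by_cases h₂ : ADEneg G g vc <;>
    simp only [h₁, h₂, true_imp_iff, not_true_eq_false, not_false_eq_true, false_imp_iff]
      at hv he <;>
    simp [h₁, h₂, hv, he]
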